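/- arXiv:1808.00581 — 10 statements merged into one kernel-verified Lean document; each statement's English description precedes it below -/
import Mathlib

section
/- Let V be a real normed vector space, let C ⊆ V and S ∈ V. Suppose there exist R ∈ C, ρ > 0, and a subset K ⊆ V closed under multiplication by positive scalars, such that the open ball of radius ρ around S is contained in K and R + K = {R + E : E ∈ K} ⊆ C. Then there exists λ₀ > 0 such that λ·S ∈ C for all λ > λ₀. -/
/-- let `C ⊆ V` and `S ∈ V` in a real normed vector space `V`. If there are
`R ∈ C`, `ρ > 0` and a set `K ⊆ V` closed under multiplication by positive scalars such
that the open ball of radius `ρ` around `S` is contained in `K` and `R + K ⊆ C`, then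
there is a `λ₀ > 0` with `λ·S ∈ C` for all `λ > λ₀`. -/
theorem stmt1 (V : Type*) [NormedAddCommGroup V] [NormedSpace ℝ V]
    (C : Set V) (S : V) (R : V) (hR : R ∈ C) (ρ : ℝ) (hρ : 0 < ρ) (K : Set V)
    (hcone : ∀ x ∈ K, ∀ t : ℝ, 0 < t → t • x ∈ K)
    (hball : Metric.ball S ρ ⊆ K)
    (htrans : ∀ E ∈ K, R + E ∈ C) :
    ∃ lam₀ : ℝ, 0 < lam₀ ∧ ∀ lam : ℝ, lam₀ < lam → lam • S ∈ C := by
  refine ⟨(‖R‖ + 1) / ρ, by positivity, fun lam hlam => ?_⟩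
  have hpos : 0 < lam := lt_trans (by positivity) hlam
  have hnorm : ‖R‖ + 1 < lam * ρ := (div_lt_iff₀ hρ).mp hlam
  have hmem : S - lam⁻¹ • R ∈ Metric.ball S ρ := by
    rw [mem_ball_iff_norm, sub_sub_cancel_left, norm_neg, norm_smul, norm_inv,
      Real.norm_of_nonneg hpos.le, inv_mul_lt_iff₀ hpos]
    linarith
  have hC := htrans _ (hcone _ (hball hmem) lam hpos)
  rwa [smul_sub, smul_inv_smul₀ hpos.ne', add_sub_cancel] at hC
end

section
/- Let n ≥ 3 and 1 ≤ p ≤ n−2. If R ∈ 𝒞_B(ℝⁿ) has positive p-curvature, i.e. s_p(R)(P) > 0 for every p-dimensional subspace P ≤ ℝⁿ and every orthonormal basis of P^⊥, then R has positive (p−1)-curvature, i.e. s_{p−1}(R)(P') > 0 for every (p−1)-dimensional subspace P' ≤ ℝⁿ and every orthonormal basis of P'^⊥. In other words, (p-curv > 0) ⊆ ((p−1)-curv > 0). -/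
open Matrix

noncomputable section

/-- The space of `n × n` real matrices. -/
abbrev Mat (n : ℕ) := Matrix (Fin n) (Fin n) ℝ

/-- The subspace `Λₙ` of skew-symmetric `n × n` real matrices, modelling `⋀²ℝⁿ`. -/
def skewSub (n : ℕ) : Submodule ℝ (Mat n) where
  carrier := {A | Aᵀ = -A}
  add_mem' := by
    intro a b ha hb
    simp only [Set.mem_setOf_eq] at *
    rw [Matrix.transpose_add, ha, hb, neg_add]
  zero_mem' := by simp [Set.mem_setOf_eq]
  smul_mem' := by
    intro c A hA
    simp only [Set.mem_setOf_eq] at *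
    rw [Matrix.transpose_smul, hA, smul_neg]

abbrev Lam (n : ℕ) := ↥(skewSub n)

/-- The inner product `⟨A, B⟩ = (1/2)·trace (Aᵀ·B)` on `Λₙ`. -/
def ip {n : ℕ} (A B : Lam n) : ℝ := (1 / 2) * ((A : Mat n)ᵀ * (B : Mat n)).trace

/-- The space of linear endomorphisms of `Λₙ`. -/
abbrev OpL (n : ℕ) := Lam n →ₗ[ℝ] Lam n

/-- The wedge `x ∧ y`, i.e. the skew-symmetric matrix `x·yᵀ − y·xᵀ`. -/
def wedge {n : ℕ} (x y : Fin n → ℝ) : Lam n :=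
  ⟨Matrix.of fun i j => x i * y j - y i * x j, by
    show _ᵀ = -_
    ext i j
    simp only [Matrix.transpose_apply, Matrix.of_apply, Matrix.neg_apply]
    ring⟩

/-- `𝒞_B(ℝⁿ)`: self-adjoint endomorphisms of `Λₙ` satisfying the first Bianchi identity. -/
def CB (n : ℕ) : Set (OpL n) :=
  {R | (∀ A B : Lam n, ip (R A) B = ip A (R B)) ∧
    ∀ x y z : Fin n → ℝ,
      ((R (wedge x y) : Mat n)) *ᵥ z + ((R (wedge y z) : Mat n)) *ᵥ x
        + ((R (wedge z x) : Mat n)) *ᵥ y = 0}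

/-- The standard basis vectors of `ℝⁿ`. -/
def sbv (n : ℕ) (i : Fin n) : Fin n → ℝ := Pi.single i 1

/-- `Ric(R, z) = Σᵢ ⟨(R (eᵢ ∧ z))·z, eᵢ⟩`. -/
def Ric {n : ℕ} (R : OpL n) (z : Fin n → ℝ) : ℝ :=
  ∑ i, (((R (wedge (sbv n i) z) : Mat n)) *ᵥ z) ⬝ᵥ (sbv n i)

/-- `scal(R) = Σᵢⱼ ⟨(R (eᵢ ∧ eⱼ))·eⱼ, eᵢ⟩`. -/
def scal {n : ℕ} (R : OpL n) : ℝ :=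
  ∑ i, ∑ j, (((R (wedge (sbv n i) (sbv n j)) : Mat n)) *ᵥ (sbv n j)) ⬝ᵥ (sbv n i)


abbrev EV (n : ℕ) := EuclideanSpace ℝ (Fin n)

/-- The wedge `x ∧ y` for euclidean vectors. -/
def wedgeE {n : ℕ} (x y : EV n) : Lam n :=
  ⟨Matrix.of fun i j => x i * y j - y i * x j, by
    show _ᵀ = -_
    ext i j
    simp only [Matrix.transpose_apply, Matrix.of_apply, Matrix.neg_apply]
    ring⟩

/-- `s_p(R)(P) = Σ_{i,j} ⟨(R (Eᵢ ∧ Eⱼ))·Eⱼ, Eᵢ⟩` for an orthonormal basis `(Eᵢ)` of `P^⊥`. -/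
def sSum {n m : ℕ} (R : OpL n) (E : Fin m → EV n) : ℝ :=
  ∑ i, ∑ j, (((R (wedgeE (E i) (E j)) : Mat n)) *ᵥ (fun k => E j k)) ⬝ᵥ (fun k => E i k)

/-- `R` has positive `p`-curvature: `s_p(R)(P) > 0` for every `p`-dimensional subspace
`P ≤ ℝⁿ` and every orthonormal basis of `P^⊥`. -/
def PosPCurv (n p : ℕ) (R : OpL n) : Prop :=
  ∀ P : Submodule ℝ (EV n), Module.finrank ℝ P = p →
    ∀ E : Fin (n - p) → EV n, Orthonormal ℝ E → (∀ i, E i ∈ Pᗮ) → 0 < sSum R E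

theorem sum_sum_succAbove {m : ℕ} (f : Fin (m + 1) → Fin (m + 1) → ℝ) (hf : ∀ i, f i i = 0) :
    ∑ k : Fin (m + 1), ∑ i, ∑ j, f (k.succAbove i) (k.succAbove j) =
      ((m : ℝ) - 1) * ∑ i, ∑ j, f i j := by
  have key (k : Fin (m + 1)) : ∑ i, ∑ j, f (k.succAbove i) (k.succAbove j) =
      ∑ i, ∑ j, f i j - ∑ j, f k j - ∑ i, f i k := by
    have hrow (i) : ∑ j, f i (k.succAbove j) = ∑ j, f i j - f i k := by
      rw [Fin.sum_univ_succAbove (f i) k]; ring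
    have hcol := Fin.sum_univ_succAbove (fun i => f i k) k
    have htot := Fin.sum_univ_succAbove (fun i => ∑ j, f i j) k
    simp only [hrow, Finset.sum_sub_distrib]
    have := hf k
    linarith
  simp only [key, Finset.sum_sub_distrib, Finset.sum_const, Finset.card_univ, Fintype.card_fin,
    nsmul_eq_mul]
  rw [Finset.sum_comm (f := fun k i => f i k)]
  push_cast
  ring

theorem wedgeE_self {n : ℕ} (x : EV n) : wedgeE x x = 0 := by
  ext i j
  simp [wedgeE]

theorem sum_sSum_succAbove {n m : ℕ} (R : OpL n) (E : Fin (m + 1) → EV n) :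
    ∑ k : Fin (m + 1), sSum R (E ∘ k.succAbove) = ((m : ℝ) - 1) * sSum R E :=
  sum_sum_succAbove
    (fun i j => ((R (wedgeE (E i) (E j)) : Mat n) *ᵥ (fun k => E j k)) ⬝ᵥ (fun k => E i k))
    fun i => by simp [wedgeE_self]

theorem PosPCurv.sSum_pos {n p m : ℕ} {R : OpL n} (h : PosPCurv n p R) (hm : m + p = n)
    {E : Fin m → EV n} (hE : Orthonormal ℝ E) : 0 < sSum R E := by
  obtain rfl : m = n - p := by omega
  refine h (Submodule.span ℝ (Set.range E))ᗮ ?_ E hE fun i =>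
    Submodule.le_orthogonal_orthogonal _ (Submodule.subset_span ⟨i, rfl⟩)
  have hspan := finrank_span_eq_card hE.linearIndependent
  have hadd := (Submodule.span ℝ (Set.range E)).finrank_add_finrank_orthogonal
  simp only [Fintype.card_fin, finrank_euclideanSpace] at hspan hadd
  omega

/-- for `1 ≤ p ≤ n − 2`, positive `p`-curvature implies positive
`(p−1)`-curvature, i.e. `(p-curv > 0) ⊆ ((p−1)-curv > 0)`. -/
theorem stmt7 (n p : ℕ) (hn : 3 ≤ n) (hp1 : 1 ≤ p) (hp2 : p ≤ n - 2)
    (R : OpL n) (hR : R ∈ CB n) (hpos : PosPCurv n p R) :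
    PosPCurv n (p - 1) R := by
  intro P _ E hE _
  obtain ⟨m, hm⟩ : ∃ m, n - (p - 1) = m + 1 := ⟨n - p, by omega⟩
  revert E
  rw [hm]
  intro E hE _
  have hm2 : (2 : ℝ) ≤ m := by exact_mod_cast (by omega : 2 ≤ m)
  have hsum : 0 < ∑ k : Fin (m + 1), sSum R (E ∘ k.succAbove) :=
    Finset.sum_pos
      (fun k _ => hpos.sSum_pos (by omega) (hE.comp _ k.succAbove_right_injective))
      Finset.univ_nonempty
  rw [sum_sSum_succAbove] at hsum
  exact pos_of_mul_pos_right hsum (by linarith)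
end
end

section
/- Let n ≥ 3 and 2 ≤ k ≤ n−1, and set c := n−k+2. Then the set (k-pos Ric) := {R ∈ 𝒞_B(ℝⁿ) : Σ_{i=1}^{k} Ric(R, vᵢ) > 0 for every orthonormal family (v₁,…,v_k) in ℝⁿ} satisfies the deformability properties: (a) 0 ∉ (k-pos Ric); (b) if R ∈ (k-pos Ric) then R + λ·L ∈ (k-pos Ric) for every λ ≥ 0; (c) μ·R_{ℝ^{n−q+1}×S^{q−1}} ∈ (k-pos Ric) for every μ > 0 and every q with c ≤ q ≤ n. -/
open Matrix

noncomputable section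

/-- `R_{ℝ^{n−q} × S^q}`: the orthogonal projection of `Λₙ` onto the subspace of matrices
whose entries outside the last `q` rows and columns vanish. -/
def projQ (n q : ℕ) : OpL n where
  toFun A :=
    ⟨Matrix.of fun i j => if n - q ≤ (i : ℕ) ∧ n - q ≤ (j : ℕ) then (A : Mat n) i j else 0, by
      have hA : ((A : Mat n))ᵀ = -(A : Mat n) := A.2
      show _ᵀ = -_
      ext i j
      simp only [Matrix.transpose_apply, Matrix.of_apply, Matrix.neg_apply]
      have h2 : (A : Mat n) j i = -(A : Mat n) i j := by
        have := congrArg (fun M : Mat n => M i j) hA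
        simpa using this
      by_cases h : n - q ≤ (i : ℕ) ∧ n - q ≤ (j : ℕ)
      · rw [if_pos ⟨h.2, h.1⟩, if_pos h]; exact h2
      · rw [if_neg (fun hc => h ⟨hc.2, hc.1⟩), if_neg h]; simp⟩
  map_add' A B := by
    apply Subtype.ext
    show Matrix.of _ = Matrix.of _ + Matrix.of _
    ext i j
    simp only [Matrix.of_apply, Submodule.coe_add, Matrix.add_apply]
    split_ifs <;> simp
  map_smul' c A := by
    apply Subtype.ext
    show Matrix.of _ = c • Matrix.of _
    ext i j
    simp only [Matrix.of_apply, Submodule.coe_smul, Matrix.smul_apply, RingHom.id_apply,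
      smul_eq_mul]
    split_ifs <;> simp

/-- `L`: the orthogonal projection of `Λₙ` onto the span of `{e₁·eⱼᵀ − eⱼ·e₁ᵀ : 2 ≤ j ≤ n}`. -/
def LOp (n : ℕ) : OpL n where
  toFun A :=
    ⟨Matrix.of fun i j => if (i : ℕ) = 0 ∨ (j : ℕ) = 0 then (A : Mat n) i j else 0, by
      have hA : ((A : Mat n))ᵀ = -(A : Mat n) := A.2
      show _ᵀ = -_
      ext i j
      simp only [Matrix.transpose_apply, Matrix.of_apply, Matrix.neg_apply]
      have h2 : (A : Mat n) j i = -(A : Mat n) i j := by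
        have := congrArg (fun M : Mat n => M i j) hA
        simpa using this
      by_cases h : (i : ℕ) = 0 ∨ (j : ℕ) = 0
      · rw [if_pos h.symm, if_pos h]; exact h2
      · rw [if_neg (fun hc => h hc.symm), if_neg h]; simp⟩
  map_add' A B := by
    apply Subtype.ext
    show Matrix.of _ = Matrix.of _ + Matrix.of _
    ext i j
    simp only [Matrix.of_apply, Submodule.coe_add, Matrix.add_apply]
    split_ifs <;> simp
  map_smul' c A := by
    apply Subtype.ext
    show Matrix.of _ = c • Matrix.of _
    ext i j
    simp only [Matrix.of_apply, Submodule.coe_smul, Matrix.smul_apply, RingHom.id_apply,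
      smul_eq_mul]
    split_ifs <;> simp

/-- The set `(k-pos Ric)` of curvature operators with `k`-positive Ricci curvature. -/
def kPosRicSet (n k : ℕ) : Set (OpL n) :=
  {R | R ∈ CB n ∧ ∀ v : Fin k → (Fin n → ℝ),
    (∀ i j, v i ⬝ᵥ v j = if i = j then (1 : ℝ) else 0) → 0 < ∑ i, Ric R (v i)}

/-- `R` acts on `Λₙ` by keeping the entries indexed by `p` and setting all others to zero. -/
def IsMask {n : ℕ} (R : OpL n) (p : Fin n → Fin n → Prop) [∀ i j, Decidable (p i j)] : Prop :=
  ∀ (A : Lam n) (i j : Fin n), (R A : Mat n) i j = if p i j then (A : Mat n) i j else 0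

theorem isMask_projQ (n q : ℕ) :
    IsMask (projQ n q) fun i j : Fin n => n - q ≤ (i : ℕ) ∧ n - q ≤ (j : ℕ) :=
  fun _ _ _ => rfl

theorem isMask_LOp (n : ℕ) : IsMask (LOp n) fun i j : Fin n => (i : ℕ) = 0 ∨ (j : ℕ) = 0 :=
  fun _ _ _ => rfl

theorem wedge_apply {n : ℕ} (x y : Fin n → ℝ) (i j : Fin n) :
    (wedge x y : Mat n) i j = x i * y j - y i * x j := rfl

theorem ip_eq_sum {n : ℕ} (A B : Lam n) :
    ip A B = 1 / 2 * ∑ i, ∑ j, (A : Mat n) j i * (B : Mat n) j i := by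
  simp [ip, Matrix.trace, Matrix.mul_apply]

theorem IsMask.mem_CB {n : ℕ} {R : OpL n} {p : Fin n → Fin n → Prop}
    [∀ i j, Decidable (p i j)] (hR : IsMask R p) : R ∈ CB n := by
  refine ⟨fun A B => ?_, fun x y z => ?_⟩
  · rw [ip_eq_sum, ip_eq_sum]
    congr 1
    refine Finset.sum_congr rfl fun i _ => Finset.sum_congr rfl fun j _ => ?_
    rw [hR, hR]
    split_ifs <;> simp
  · ext i
    simp only [Pi.add_apply, Pi.zero_apply, Matrix.mulVec, dotProduct]
    rw [← Finset.sum_add_distrib, ← Finset.sum_add_distrib]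
    refine Finset.sum_eq_zero fun j _ => ?_
    rw [hR, hR, hR, wedge_apply, wedge_apply, wedge_apply]
    split_ifs <;> ring

theorem add_mem_CB {n : ℕ} {R S : OpL n} (hR : R ∈ CB n) (hS : S ∈ CB n) : R + S ∈ CB n := by
  refine ⟨fun A B => ?_, fun x y z => ?_⟩
  · have h1 := hR.1 A B
    have h2 := hS.1 A B
    simp only [ip, LinearMap.add_apply, Submodule.coe_add, Matrix.transpose_add, Matrix.add_mul,
      Matrix.mul_add, Matrix.trace_add] at *
    linarith
  · have h1 := hR.2 x y z
    have h2 := hS.2 x y z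
    simp only [LinearMap.add_apply, Submodule.coe_add, Matrix.add_mulVec]
    rw [← add_zero (0 : Fin n → ℝ)]
    nth_rw 1 [← h1]
    rw [← h2]
    abel

theorem smul_mem_CB {n : ℕ} {R : OpL n} (hR : R ∈ CB n) (c : ℝ) : c • R ∈ CB n := by
  refine ⟨fun A B => ?_, fun x y z => ?_⟩
  · have h1 := hR.1 A B
    simp only [ip, LinearMap.smul_apply, Submodule.coe_smul, Matrix.transpose_smul,
      Matrix.smul_mul, Matrix.mul_smul, Matrix.trace_smul, smul_eq_mul] at *
    linear_combination c * h1
  · have h1 := hR.2 x y z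
    simp only [LinearMap.smul_apply, Submodule.coe_smul, Matrix.smul_mulVec]
    rw [← smul_add, ← smul_add, h1, smul_zero]

theorem Ric_add {n : ℕ} (R S : OpL n) (z : Fin n → ℝ) : Ric (R + S) z = Ric R z + Ric S z := by
  simp [Ric, Matrix.add_mulVec, add_dotProduct, Finset.sum_add_distrib]

theorem Ric_smul {n : ℕ} (c : ℝ) (R : OpL n) (z : Fin n → ℝ) : Ric (c • R) z = c * Ric R z := by
  simp [Ric, Matrix.smul_mulVec, smul_dotProduct, Finset.mul_sum]

theorem Ric_zero {n : ℕ} (z : Fin n → ℝ) : Ric (0 : OpL n) z = 0 := by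
  simpa using Ric_smul 0 (0 : OpL n) z

theorem IsMask.Ric_eq {n : ℕ} {R : OpL n} {p : Fin n → Fin n → Prop}
    [∀ i j, Decidable (p i j)] (hR : IsMask R p) (z : Fin n → ℝ) :
    Ric R z = ∑ i, ∑ j, if p i j ∧ i ≠ j then z j ^ 2 else 0 := by
  refine Finset.sum_congr rfl fun i _ => ?_
  rw [sbv, dotProduct_single_one, Matrix.mulVec, dotProduct]
  refine Finset.sum_congr rfl fun j _ => ?_
  rw [hR, wedge_apply]
  by_cases hij : i = j
  · subst hij
    simp
  · by_cases hp : p i j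
    · simp [hij, hp, Ne.symm hij]
      ring
    · simp [hp]

theorem IsMask.Ric_nonneg {n : ℕ} {R : OpL n} {p : Fin n → Fin n → Prop}
    [∀ i j, Decidable (p i j)] (hR : IsMask R p) (z : Fin n → ℝ) : 0 ≤ Ric R z := by
  rw [hR.Ric_eq]
  refine Finset.sum_nonneg fun i _ => Finset.sum_nonneg fun j _ => ?_
  split_ifs <;> positivity

theorem IsMask.Ric_pos {n : ℕ} {R : OpL n} {p : Fin n → Fin n → Prop}
    [∀ i j, Decidable (p i j)] (hR : IsMask R p) {z : Fin n → ℝ} {i j : Fin n}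
    (hp : p i j) (hij : i ≠ j) (hz : z j ≠ 0) : 0 < Ric R z := by
  have hterm : ∀ a b, 0 ≤ if p a b ∧ a ≠ b then z b ^ 2 else 0 := fun a b => by
    split_ifs <;> positivity
  rw [hR.Ric_eq]
  refine Finset.sum_pos' (fun a _ => Finset.sum_nonneg fun b _ => hterm a b)
    ⟨i, Finset.mem_univ i, Finset.sum_pos' (fun b _ => hterm i b) ⟨j, Finset.mem_univ j, ?_⟩⟩
  rw [if_pos ⟨hp, hij⟩]
  positivity

/-- Among more than `m` orthonormal vectors, one has a nonzero coordinate of index at least `m`. -/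
theorem exists_coord_ne_zero_of_orthonormal {n k m : ℕ} (hmk : m < k)
    {v : Fin k → Fin n → ℝ} (hv : ∀ i j, v i ⬝ᵥ v j = if i = j then (1 : ℝ) else 0) :
    ∃ (i : Fin k) (j : Fin n), m ≤ (j : ℕ) ∧ v i j ≠ 0 := by
  by_contra! h
  let W : Matrix (Fin k) {j : Fin n // (j : ℕ) < m} ℝ := Matrix.of fun i j => v i j
  have hW : W * Wᵀ = 1 := by
    ext a b
    rw [Matrix.one_apply, ← hv a b, Matrix.mul_apply, dotProduct,
      ← Fintype.sum_subtype_add_sum_subtype (fun j : Fin n => (j : ℕ) < m)]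
    rw [Fintype.sum_eq_zero (fun j : {j : Fin n // ¬ (j : ℕ) < m} => v a j * v b j)
      fun j => by rw [h a j (not_lt.mp j.2), zero_mul], add_zero]
    rfl
  have hcard : Fintype.card {j : Fin n // (j : ℕ) < m} ≤ m := by
    simpa using Fintype.card_le_of_injective
      (fun j : {j : Fin n // (j : ℕ) < m} => (⟨j.1, j.2⟩ : Fin m))
      fun a b hab => Subtype.ext (Fin.ext (by simpa using hab))
  have hrank : k ≤ W.rank := by
    simpa [hW] using Matrix.rank_mul_le_left W Wᵀ
  have := W.rank_le_card_width
  omega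

/-- for `2 ≤ k ≤ n − 1` and `c = n − k + 2`, the condition `(k-pos Ric)`
is deformable: (a) `0 ∉ (k-pos Ric)`; (b) it satisfies an inner ray condition with
respect to `L`; (c) `μ·R_{ℝ^{n−q+1} × S^{q−1}} ∈ (k-pos Ric)` for all `μ > 0`, `c ≤ q ≤ n`. -/
theorem stmt9 (n k : ℕ) (hn : 3 ≤ n) (hk1 : 2 ≤ k) (hk2 : k ≤ n - 1) :
    (0 : OpL n) ∉ kPosRicSet n k ∧
      (∀ R ∈ kPosRicSet n k, ∀ lam : ℝ, 0 ≤ lam → R + lam • LOp n ∈ kPosRicSet n k) ∧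
      (∀ μ : ℝ, 0 < μ → ∀ q : ℕ, n - k + 2 ≤ q → q ≤ n →
        μ • projQ n (q - 1) ∈ kPosRicSet n k) := by
  refine ⟨fun h => ?_, fun R hR lam hlam => ⟨?_, fun v hv => ?_⟩,
    fun μ hμ q hq hqn => ⟨?_, fun v hv => ?_⟩⟩
  · have h0 := h.2 (fun i => Pi.single (Fin.castLE (by omega) i) 1) fun i j => by
      simp [Pi.single_apply, eq_comm]
    simp [Ric_zero] at h0
  · exact add_mem_CB hR.1 (smul_mem_CB (isMask_LOp n).mem_CB lam)
  · simp only [Ric_add, Ric_smul, Finset.sum_add_distrib]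
    exact add_pos_of_pos_of_nonneg (hR.2 v hv) (Finset.sum_nonneg fun i _ =>
      mul_nonneg hlam ((isMask_LOp n).Ric_nonneg _))
  · exact smul_mem_CB (isMask_projQ n (q - 1)).mem_CB μ
  · simp only [Ric_smul, ← Finset.mul_sum]
    refine mul_pos hμ ?_
    obtain ⟨i, j, hj, hij⟩ :=
      exists_coord_ne_zero_of_orthonormal (m := n - (q - 1)) (by omega) hv
    refine Finset.sum_pos' (fun a _ => (isMask_projQ n (q - 1)).Ric_nonneg _)
      ⟨i, Finset.mem_univ i, ?_⟩
    obtain ⟨l, hl, hlj⟩ : ∃ l : Fin n, n - (q - 1) ≤ (l : ℕ) ∧ l ≠ j := by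
      by_cases hj' : (j : ℕ) = n - 1
      · exact ⟨⟨n - 2, by omega⟩, by simp only; omega, by rw [Ne, Fin.ext_iff]; simp only; omega⟩
      · exact ⟨⟨n - 1, by omega⟩, by simp only; omega, by rw [Ne, Fin.ext_iff]; simp only; omega⟩
    exact (isMask_projQ n (q - 1)).Ric_pos ⟨hl, hj⟩ hlj hij
end
end

section
/- Let n ≥ 3 and 0 ≤ p ≤ n−3, and set c := p+3. Then the set (p-curv > 0) := {R ∈ 𝒞_B(ℝⁿ) : s_p(R)(P) > 0 for every p-dimensional subspace P ≤ ℝⁿ} satisfies the deformability properties: (a) 0 ∉ (p-curv > 0); (b) if R ∈ (p-curv > 0) then R + λ·L ∈ (p-curv > 0) for every λ ≥ 0; (c) μ·R_{ℝ^{n−q+1}×S^{q−1}} ∈ (p-curv > 0) for every μ > 0 and every q with c ≤ q ≤ n. -/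
open Matrix

noncomputable section

/-- The set `(p-curv > 0)` of curvature operators with positive `p`-curvature:
`s_p(R)(P) > 0` for every `p`-dimensional subspace `P ≤ ℝⁿ` (computed with respect to
any orthonormal basis of `P^⊥`). -/
def pCurvSet (n p : ℕ) : Set (OpL n) :=
  {R | R ∈ CB n ∧ ∀ P : Submodule ℝ (EV n), Module.finrank ℝ P = p →
    ∀ E : Fin (n - p) → EV n, Orthonormal ℝ E → (∀ i, E i ∈ Pᗮ) → 0 < sSum R E}

/-- `R` acts on matrices by entrywise multiplication with the weights `m`. -/
def IsEntrywise {n : ℕ} (R : OpL n) (m : Fin n → Fin n → ℝ) : Prop :=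
  ∀ (A : Lam n) (i j : Fin n), (R A : Mat n) i j = m i j * (A : Mat n) i j

theorem IsEntrywise.smul {n : ℕ} {R : OpL n} {m : Fin n → Fin n → ℝ} (h : IsEntrywise R m)
    (c : ℝ) : IsEntrywise (c • R) (fun i j => c * m i j) := by
  intro A i j
  change c * (R A : Mat n) i j = _
  rw [h A i j, mul_assoc]

theorem isEntrywise_projQ (n q : ℕ) :
    IsEntrywise (projQ n q) (fun i j => if n - q ≤ (i : ℕ) ∧ n - q ≤ (j : ℕ) then 1 else 0) := by
  intro A i j
  simp only [ite_mul, one_mul, zero_mul]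
  rfl

theorem isEntrywise_LOp (n : ℕ) :
    IsEntrywise (LOp n) (fun i j => if (i : ℕ) = 0 ∨ (j : ℕ) = 0 then 1 else 0) := by
  intro A i j
  simp only [ite_mul, one_mul, zero_mul]
  rfl

theorem IsEntrywise.mem_CB {n : ℕ} {R : OpL n} {m : Fin n → Fin n → ℝ} (h : IsEntrywise R m) :
    R ∈ CB n := by
  refine ⟨fun A B => ?_, fun x y z => ?_⟩
  · simp only [ip, Matrix.trace, Matrix.diag, Matrix.mul_apply, Matrix.transpose_apply, h A, h B]
    congr 1
    refine Finset.sum_congr rfl fun i _ => Finset.sum_congr rfl fun j _ => ?_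
    ring
  · ext i
    simp only [Pi.add_apply, Matrix.mulVec, dotProduct, h (wedge _ _), Pi.zero_apply,
      ← Finset.sum_add_distrib]
    refine Finset.sum_eq_zero fun j _ => ?_
    simp only [wedge, Matrix.of_apply]
    ring

theorem sSum_add {n m : ℕ} (R S : OpL n) (E : Fin m → EV n) :
    sSum (R + S) E = sSum R E + sSum S E := by
  simp only [sSum, LinearMap.add_apply, Submodule.coe_add, Matrix.add_mulVec, add_dotProduct,
    Finset.sum_add_distrib]

/-- The sectional term of an entrywise operator is a weighted sum of squares of `2 × 2` minors. -/
theorem IsEntrywise.sectional_eq {n : ℕ} {R : OpL n} {m : Fin n → Fin n → ℝ}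
    (h : IsEntrywise R m) (hm : ∀ i j, m i j = m j i) (x y : EV n) :
    ((R (wedgeE x y) : Mat n) *ᵥ (fun k => y k)) ⬝ᵥ (fun k => x k) =
      (1 / 2) * ∑ i, ∑ j, m i j * (x i * y j - y i * x j) ^ 2 := by
  have key : ((R (wedgeE x y) : Mat n) *ᵥ (fun k => y k)) ⬝ᵥ (fun k => x k) =
      ∑ i, ∑ j, m i j * (x i * y j - y i * x j) * (x i * y j) := by
    simp only [Matrix.mulVec, dotProduct, h (wedgeE x y), Finset.sum_mul]
    refine Finset.sum_congr rfl fun i _ => Finset.sum_congr rfl fun j _ => ?_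
    simp only [wedgeE, Matrix.of_apply]
    ring
  have swap : ∑ i, ∑ j, m i j * (x i * y j - y i * x j) * (x i * y j) =
      ∑ i, ∑ j, -(m i j * (x i * y j - y i * x j) * (y i * x j)) := by
    rw [Finset.sum_comm]
    refine Finset.sum_congr rfl fun i _ => Finset.sum_congr rfl fun j _ => ?_
    rw [hm j i]
    ring
  have add : ∑ i, ∑ j, m i j * (x i * y j - y i * x j) ^ 2 =
      ∑ i, ∑ j, m i j * (x i * y j - y i * x j) * (x i * y j) +
      ∑ i, ∑ j, -(m i j * (x i * y j - y i * x j) * (y i * x j)) := by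
    simp only [← Finset.sum_add_distrib]
    refine Finset.sum_congr rfl fun i _ => Finset.sum_congr rfl fun j _ => ?_
    ring
  rw [key, add, ← swap]
  ring

theorem IsEntrywise.sSum_nonneg {n k : ℕ} {R : OpL n} {m : Fin n → Fin n → ℝ}
    (h : IsEntrywise R m) (hm : ∀ i j, m i j = m j i) (h0 : ∀ i j, 0 ≤ m i j)
    (E : Fin k → EV n) : 0 ≤ sSum R E := by
  unfold sSum
  refine Finset.sum_nonneg fun a _ => Finset.sum_nonneg fun b _ => ?_
  rw [h.sectional_eq hm]
  exact mul_nonneg (by norm_num) <| Finset.sum_nonneg fun i _ => Finset.sum_nonneg fun j _ =>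
    mul_nonneg (h0 i j) (sq_nonneg _)

theorem IsEntrywise.minor_eq_zero {n k : ℕ} {R : OpL n} {m : Fin n → Fin n → ℝ}
    (h : IsEntrywise R m) (hm : ∀ i j, m i j = m j i) (h0 : ∀ i j, 0 ≤ m i j)
    {E : Fin k → EV n} (hE : sSum R E ≤ 0) (a b : Fin k) {i j : Fin n} (hij : 0 < m i j) :
    E a i * E b j - E b i * E a j = 0 := by
  have term : ∀ a b i j, 0 ≤ m i j * (E a i * E b j - E b i * E a j) ^ 2 := fun a b i j =>
    mul_nonneg (h0 i j) (sq_nonneg _)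
  have inner : ∀ a b, 0 ≤ (1 / 2) * ∑ i, ∑ j, m i j * (E a i * E b j - E b i * E a j) ^ 2 :=
    fun a b => mul_nonneg (by norm_num) <|
      Finset.sum_nonneg fun i _ => Finset.sum_nonneg fun j _ => term a b i j
  have hz := le_antisymm hE (h.sSum_nonneg hm h0 E)
  simp only [sSum, h.sectional_eq hm] at hz
  rw [Finset.sum_eq_zero_iff_of_nonneg fun a _ => Finset.sum_nonneg fun b _ => inner a b] at hz
  have hz := hz a (Finset.mem_univ a)
  rw [Finset.sum_eq_zero_iff_of_nonneg fun b _ => inner a b] at hz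
  have hz := (mul_eq_zero.mp (hz b (Finset.mem_univ b))).resolve_left (by norm_num)
  rw [Finset.sum_eq_zero_iff_of_nonneg fun i _ => Finset.sum_nonneg fun j _ => term a b i j] at hz
  have hz := hz i (Finset.mem_univ i)
  rw [Finset.sum_eq_zero_iff_of_nonneg fun j _ => term a b i j] at hz
  have hz := (mul_eq_zero.mp (hz j (Finset.mem_univ j))).resolve_left hij.ne'
  exact pow_eq_zero_iff (by norm_num) |>.mp hz

/-- If a linearly independent family has vanishing `2 × 2` minors in all coordinates from `k` on,
then it has at most `k + 1` members. -/
theorem card_le_of_minors_eq_zero {n k d : ℕ} (hn : 0 < n) (hk : k ≤ n) {E : Fin d → EV n}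
    (hE : LinearIndependent ℝ E)
    (h : ∀ a b (i j : Fin n), k ≤ (i : ℕ) → k ≤ (j : ℕ) → E a i * E b j - E b i * E a j = 0) :
    d ≤ k + 1 := by
  obtain ⟨i₀, hi₀⟩ : ∃ i₀ : Fin n, ∀ j : Fin n, k ≤ (j : ℕ) → ∃ r : ℝ, ∀ a,
      E a j = r * E a i₀ := by
    by_cases hz : ∀ a (j : Fin n), k ≤ (j : ℕ) → E a j = 0
    · exact ⟨⟨0, hn⟩, fun j hj => ⟨0, fun a => by rw [hz a j hj, zero_mul]⟩⟩
    · push Not at hz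
      obtain ⟨a₀, i₀, hi, hne⟩ := hz
      refine ⟨i₀, fun j hj => ⟨E a₀ j / E a₀ i₀, fun a => ?_⟩⟩
      have := h a₀ a i₀ j hi hj
      field_simp
      linarith
  let φ : EV n →ₗ[ℝ] (Fin k → ℝ) × ℝ :=
    { toFun := fun v => (fun i => v (Fin.castLE hk i), v i₀)
      map_add' := fun _ _ => rfl
      map_smul' := fun _ _ => rfl }
  have hdisj : Disjoint (Submodule.span ℝ (Set.range E)) (LinearMap.ker φ) := by
    rw [Submodule.disjoint_def]
    intro v hv hφ
    have hφ : φ v = 0 := hφ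
    have h₀ : v i₀ = 0 := congrArg Prod.snd hφ
    ext j
    by_cases hj : k ≤ (j : ℕ)
    · obtain ⟨r, hr⟩ := hi₀ j hj
      have hvj : v j = r * v i₀ := by
        refine Submodule.span_induction (p := fun w _ => w j = r * w i₀) ?_ ?_ ?_ ?_ hv
        · rintro _ ⟨a, rfl⟩
          exact hr a
        · simp
        · intro x y _ _ hx hy
          simp only [PiLp.add_apply, hx, hy, mul_add]
        · intro c x _ hx
          simp only [PiLp.smul_apply, smul_eq_mul, hx]
          ring
      simp [hvj, h₀]
    · exact congrFun (congrArg Prod.fst hφ) ⟨j, not_le.mp hj⟩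
  simpa using (hE.map hdisj).fintype_card_le_finrank

/-- for `0 ≤ p ≤ n − 3` and `c = p + 3`, the condition `(p-curv > 0)`
is deformable: (a) `0 ∉ (p-curv > 0)`; (b) it satisfies an inner ray condition with
respect to `L`; (c) `μ·R_{ℝ^{n−q+1} × S^{q−1}} ∈ (p-curv > 0)` for all `μ > 0`, `c ≤ q ≤ n`. -/
theorem stmt10 (n p : ℕ) (hn : 3 ≤ n) (hp : p ≤ n - 3) :
    (0 : OpL n) ∉ pCurvSet n p ∧
      (∀ R ∈ pCurvSet n p, ∀ lam : ℝ, 0 ≤ lam → R + lam • LOp n ∈ pCurvSet n p) ∧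
      (∀ μ : ℝ, 0 < μ → ∀ q : ℕ, p + 3 ≤ q → q ≤ n →
        μ • projQ n (q - 1) ∈ pCurvSet n p) := by
  refine ⟨?_, ?_, ?_⟩
  · rintro ⟨-, h⟩
    let b := EuclideanSpace.basisFun (Fin n) ℝ
    let E : Fin (n - p) → EV n := fun i => b (Fin.castLE (Nat.sub_le n p) i)
    have hE : Orthonormal ℝ E := b.orthonormal.comp _ (Fin.castLE_injective _)
    have hdim : Module.finrank ℝ (Submodule.span ℝ (Set.range E))ᗮ = p := by
      have h1 := (Submodule.span ℝ (Set.range E)).finrank_add_finrank_orthogonal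
      rw [finrank_span_eq_card hE.linearIndependent, Fintype.card_fin,
        finrank_euclideanSpace_fin] at h1
      omega
    have := h _ hdim E hE fun i =>
      Submodule.le_orthogonal_orthogonal _ (Submodule.subset_span ⟨i, rfl⟩)
    simp [sSum] at this
  · rintro R ⟨hR, h⟩ lam hlam
    have hL := (isEntrywise_LOp n).smul lam
    refine ⟨add_mem_CB hR hL.mem_CB, fun P hP E hE hEP => ?_⟩
    rw [sSum_add]
    refine add_pos_of_pos_of_nonneg (h P hP E hE hEP) (hL.sSum_nonneg (fun i j => ?_)
      (fun i j => ?_) E)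
    · simp only [or_comm]
    · split_ifs <;> simp [hlam]
  · intro μ hμ q hq hqn
    have hQ := (isEntrywise_projQ n (q - 1)).smul μ
    refine ⟨hQ.mem_CB, fun P _ E hE _ => ?_⟩
    by_contra! hle
    have := card_le_of_minors_eq_zero (k := n - (q - 1)) (by omega) (Nat.sub_le _ _)
      hE.linearIndependent fun a b i j hi hj =>
        hQ.minor_eq_zero (fun i j => by simp only [and_comm])
          (fun i j => by split_ifs <;> simp [hμ.le]) hle a b (by simp [hi, hj, hμ])
    omega
end
end

section
/- Let q ≥ 1, δ > 0, and let α, β: (0,δ) → ℝ be differentiable with α'(r)² + β'(r)² = 1 for all r ∈ (0,δ). Define F: (0,δ) × ℝ^q → ℝ × ℝ^q by F(r,x) := (α(r), β(r)·x). Then F is differentiable, its derivative at (r,θ) applied to (s,v) ∈ ℝ × ℝ^q equals (α'(r)·s, β'(r)·s·θ + β(r)·v), and for every r ∈ (0,δ), every θ ∈ ℝ^q with ‖θ‖ = 1, and every (s,v) with ⟨θ,v⟩ = 0, one has ‖DF(r,θ)(s,v)‖² = s² + β(r)²·‖v‖². -/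
open scoped RealInnerProductSpace

/-- The derivative of `(r, x) ↦ (a r, b r • x)`. -/
theorem hasFDerivAt_prodMk_smul {E : Type*} [NormedAddCommGroup E] [NormedSpace ℝ E]
    {a b : ℝ → ℝ} {a' b' r : ℝ} (ha : HasDerivAt a a' r) (hb : HasDerivAt b b' r) (x : E) :
    HasFDerivAt (fun p : ℝ × E => (a p.1, b p.1 • p.2))
      ((a' • ContinuousLinearMap.fst ℝ ℝ E).prod
        (b r • ContinuousLinearMap.snd ℝ ℝ E +
          (b' • ContinuousLinearMap.fst ℝ ℝ E).smulRight x)) (r, x) := by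
  have h1 : HasFDerivAt (fun p : ℝ × E => p.1) (ContinuousLinearMap.fst ℝ ℝ E) (r, x) :=
    hasFDerivAt_fst
  have h2 : HasFDerivAt (fun p : ℝ × E => p.2) (ContinuousLinearMap.snd ℝ ℝ E) (r, x) :=
    hasFDerivAt_snd
  exact (ha.comp_hasFDerivAt (r, x) h1).prodMk ((hb.comp_hasFDerivAt (r, x) h1).smul h2)

/-- Pythagoras for a linear combination of a unit vector and a vector orthogonal to it. -/
theorem norm_smul_add_smul_sq_of_inner_eq_zero {E : Type*} [NormedAddCommGroup E]
    [InnerProductSpace ℝ E] {x v : E} (hx : ‖x‖ = 1) (hxv : ⟪x, v⟫ = (0 : ℝ)) (c d : ℝ) :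
    ‖c • x + d • v‖ ^ 2 = c ^ 2 + d ^ 2 * ‖v‖ ^ 2 := by
  rw [norm_add_sq_real, real_inner_smul_left, real_inner_smul_right, hxv, norm_smul, norm_smul,
    hx, mul_pow, mul_pow, Real.norm_eq_abs, Real.norm_eq_abs, sq_abs, sq_abs]
  ring

/-- for `α, β : (0,δ) → ℝ` differentiable with `α'² + β'² = 1`, the map
`F(r, x) = (α(r), β(r)·x)` is differentiable, its derivative at `(r, θ)` applied to
`(s, v)` is `(α'(r)·s, β'(r)·s·θ + β(r)·v)`, and for `‖θ‖ = 1` and `⟨θ, v⟩ = 0` the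
(euclidean) square norm of `DF(r,θ)(s,v)` equals `s² + β(r)²·‖v‖²`. -/
theorem stmt13 (q : ℕ) (hq : 1 ≤ q) (δ : ℝ) (hδ : 0 < δ)
    (α β α' β' : ℝ → ℝ)
    (hα : ∀ r ∈ Set.Ioo (0 : ℝ) δ, HasDerivAt α (α' r) r)
    (hβ : ∀ r ∈ Set.Ioo (0 : ℝ) δ, HasDerivAt β (β' r) r)
    (harc : ∀ r ∈ Set.Ioo (0 : ℝ) δ, α' r ^ 2 + β' r ^ 2 = 1)
    (F : ℝ × EuclideanSpace ℝ (Fin q) → ℝ × EuclideanSpace ℝ (Fin q))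
    (hF : ∀ p, F p = (α p.1, β p.1 • p.2)) :
    ∀ r ∈ Set.Ioo (0 : ℝ) δ, ∀ θ : EuclideanSpace ℝ (Fin q),
      DifferentiableAt ℝ F (r, θ) ∧
      (∀ (s : ℝ) (v : EuclideanSpace ℝ (Fin q)),
        fderiv ℝ F (r, θ) (s, v) = (α' r * s, (β' r * s) • θ + β r • v)) ∧
      (‖θ‖ = 1 → ∀ (s : ℝ) (v : EuclideanSpace ℝ (Fin q)), ⟪θ, v⟫ = (0 : ℝ) →
        (fderiv ℝ F (r, θ) (s, v)).1 ^ 2 + ‖(fderiv ℝ F (r, θ) (s, v)).2‖ ^ 2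
          = s ^ 2 + β r ^ 2 * ‖v‖ ^ 2) := by
  intro r hr θ
  have hD := hasFDerivAt_prodMk_smul (hα r hr) (hβ r hr) θ
  rw [← funext hF] at hD
  have hDF : ∀ (s : ℝ) (v : EuclideanSpace ℝ (Fin q)),
      fderiv ℝ F (r, θ) (s, v) = (α' r * s, (β' r * s) • θ + β r • v) := by
    intro s v
    rw [hD.fderiv]
    simp [add_comm]
  refine ⟨hD.differentiableAt, hDF, fun hθ s v hθv => ?_⟩
  rw [hDF, norm_smul_add_smul_sq_of_inner_eq_zero hθ hθv]
  linear_combination s ^ 2 * harc r hr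
end

section
/- For every c > 0, r̄ > 0 and θ₀ ∈ (0, π/2), there exist b > 0 and a smooth non-decreasing function θ: [0,b] → [0, π/2] such that: θ ≡ θ₀ on a neighbourhood of 0; θ ≡ π/2 on a neighbourhood of b; the function r(s) := r̄ − ∫₀^s cos(θ(u)) du satisfies r(s) > 0 for all s ∈ [0,b]; and θ'(s)·r(s) ≤ c·sin(θ(s)) for all s ∈ [0,b]. -/
open Real

/-- The primitive of a smooth function is smooth. -/
theorem contDiff_primitive {f : ℝ → ℝ} (hf : ContDiff ℝ (⊤ : ℕ∞) f) (a : ℝ) :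
    ContDiff ℝ (⊤ : ℕ∞) (fun t => ∫ u in a..t, f u) := by
  have hd : ∀ t, HasDerivAt (fun t => ∫ u in a..t, f u) (f t) t := fun t =>
    (hf.continuous.integral_hasStrictDerivAt a t).hasDerivAt
  refine contDiff_infty_iff_deriv.2 ⟨fun t => (hd t).differentiableAt, ?_⟩
  rwa [funext fun t => (hd t).deriv]

/-- A smooth function on the line whose derivative is bounded below by a positive constant
has a smooth global inverse. -/
theorem exists_contDiff_inverse {f f' : ℝ → ℝ} {m : ℝ} (hm : 0 < m)
    (hf : ContDiff ℝ (⊤ : ℕ∞) f) (hd : ∀ t, HasDerivAt f (f' t) t) (hlow : ∀ t, m ≤ f' t) :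
    ∃ g : ℝ → ℝ, ContDiff ℝ (⊤ : ℕ∞) g ∧ StrictMono g ∧
      (∀ t, g (f t) = t) ∧ ∀ s, f (g s) = s := by
  have hpos : ∀ t, 0 < f' t := fun t => hm.trans_le (hlow t)
  have hmono : StrictMono f := strictMono_of_deriv_pos fun t => by
    rw [(hd t).deriv]; exact hpos t
  have hsub : Monotone (fun t => f t - m * t) := by
    have hd' : ∀ t, HasDerivAt (fun t => f t - m * t) (f' t - m * 1) t := fun t =>
      (hd t).sub ((hasDerivAt_id t).const_mul m)
    refine monotone_of_deriv_nonneg (fun t => (hd' t).differentiableAt) fun t => ?_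
    rw [(hd' t).deriv]
    linarith [hlow t]
  have hsurj : Function.Surjective f := by
    refine hf.continuous.surjective ?_ ?_
    · refine Filter.tendsto_atTop_mono' _ ?_ (Filter.tendsto_atTop_add_const_right _ (f 0)
        (Filter.tendsto_id.const_mul_atTop hm))
      filter_upwards [Filter.eventually_ge_atTop 0] with t ht
      have := hsub ht
      simp only [id] at this ⊢
      linarith
    · refine Filter.tendsto_atBot_mono' _ ?_ (Filter.tendsto_atBot_add_const_right _ (f 0)
        (Filter.tendsto_id.const_mul_atBot hm))
      filter_upwards [Filter.eventually_le_atBot 0] with t ht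
      have := hsub ht
      simp only [id] at this ⊢
      linarith
  let e := hmono.orderIsoOfSurjective f hsurj
  exact ⟨e.symm, e.toHomeomorph.contDiff_symm_deriv (fun t => (hpos t).ne') hd hf,
    e.symm.strictMono, e.symm_apply_apply, e.apply_symm_apply⟩

/-- Two values `p ≤ q` can be joined by a smooth monotone function with arbitrarily small slope. -/
theorem exists_slow_transition {p q ε : ℝ} (hpq : p ≤ q) (hε : 0 < ε) :
    ∃ T : ℝ, 0 < T ∧ ∃ φ : ℝ → ℝ, ContDiff ℝ (⊤ : ℕ∞) φ ∧ Monotone φ ∧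
      (∀ t, φ t ∈ Set.Icc p q) ∧ (∀ t ≤ T, φ t = p) ∧ (∀ t, 2 * T ≤ t → φ t = q) ∧
      ∀ t ∈ Set.Icc 0 (3 * T), deriv φ t ≤ ε := by
  have hψ : ContDiff ℝ (⊤ : ℕ∞) smoothTransition := smoothTransition.contDiff
  obtain ⟨K, hK⟩ := (isCompact_Icc (a := (-1 : ℝ)) (b := 2)).exists_bound_of_continuousOn
    (contDiff_infty_iff_deriv.1 hψ).2.continuous.continuousOn
  have hK0 : 0 ≤ K := (norm_nonneg _).trans (hK 0 (by norm_num))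
  have hqp : 0 ≤ q - p := sub_nonneg.2 hpq
  set T : ℝ := (q - p) * K / ε + 1 with hT
  have hT0 : 0 < T := by positivity
  have hslope : (q - p) * K ≤ ε * T := by
    rw [hT, mul_add, mul_div_cancel₀ _ hε.ne']
    linarith
  refine ⟨T, hT0, fun t => p + (q - p) * smoothTransition (t / T - 1), ?_, ?_, ?_, ?_, ?_, ?_⟩
  · exact contDiff_const.add (contDiff_const.mul
      (hψ.comp ((contDiff_id.div_const T).sub contDiff_const)))
  · intro s t hst
    have h : smoothTransition (s / T - 1) ≤ smoothTransition (t / T - 1) :=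
      smoothTransition.monotone (by gcongr)
    have := mul_le_mul_of_nonneg_left h hqp
    simpa using this
  · intro t
    have h0 := smoothTransition.nonneg (t / T - 1)
    have h1 := smoothTransition.le_one (t / T - 1)
    constructor <;> nlinarith
  · intro t ht
    have : t / T ≤ 1 := (div_le_one hT0).2 ht
    simp [smoothTransition.zero_of_nonpos (sub_nonpos.2 this)]
  · intro t ht
    have : 2 ≤ t / T := (le_div_iff₀ hT0).2 ht
    simp [smoothTransition.one_of_one_le (show 1 ≤ t / T - 1 by linarith)]
  · rintro t ⟨ht0, ht3⟩
    have hx : t / T - 1 ∈ Set.Icc (-1 : ℝ) 2 := by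
      have h0 : 0 ≤ t / T := by positivity
      have h3 : t / T ≤ 3 := (div_le_iff₀ hT0).2 ht3
      constructor <;> linarith
    have hd : HasDerivAt (fun t => p + (q - p) * smoothTransition (t / T - 1))
        ((q - p) * (deriv smoothTransition (t / T - 1) * (1 / T))) t :=
      ((((contDiff_infty_iff_deriv.1 hψ).1 _).hasDerivAt.comp t
        (((hasDerivAt_id t).div_const T).sub_const 1)).const_mul (q - p)).const_add p
    have hb : deriv smoothTransition (t / T - 1) ≤ K := (le_abs_self _).trans (hK _ hx)
    rw [hd.deriv, mul_one_div, mul_div_assoc', div_le_iff₀ hT0]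
    exact (mul_le_mul_of_nonneg_left hb hqp).trans hslope

/-- A smooth angle profile `Θ` that equals `π / 2` from time `t₁` on can be reparametrized by an
arc length in such a way that the slope of the angle times the radius, `r̄` minus the integral of
the cosine of the angle, is the derivative of `Θ`, while the radius stays positive. -/
theorem exists_arcLength_reparametrization {rbar t₁ : ℝ} (hrbar : 0 < rbar) {Θ : ℝ → ℝ}
    (hΘ : ContDiff ℝ (⊤ : ℕ∞) Θ) (hcos : ∀ t, 0 ≤ cos (Θ t)) (hend : ∀ t, t₁ ≤ t → Θ t = π / 2) :
    ∃ σ : ℝ → ℝ, ContDiff ℝ (⊤ : ℕ∞) σ ∧ StrictMono σ ∧ Function.Surjective σ ∧ σ 0 = 0 ∧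
      ∀ s, 0 < rbar - ∫ u in (0 : ℝ)..s, cos (Θ (σ u)) ∧
        deriv (fun s => Θ (σ s)) s * (rbar - ∫ u in (0 : ℝ)..s, cos (Θ (σ u))) =
          deriv Θ (σ s) := by
  have hcosΘ : ContDiff ℝ (⊤ : ℕ∞) (fun t => cos (Θ t)) := contDiff_cos.comp hΘ
  set A : ℝ → ℝ := fun t => ∫ u in (0 : ℝ)..t, cos (Θ u) with hA
  have hAsmooth : ContDiff ℝ (⊤ : ℕ∞) A := contDiff_primitive hcosΘ 0
  have hAd : ∀ t, HasDerivAt A (cos (Θ t)) t := fun t =>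
    (hcosΘ.continuous.integral_hasStrictDerivAt 0 t).hasDerivAt
  have hAmono : Monotone A := monotone_of_deriv_nonneg (fun t => (hAd t).differentiableAt)
    fun t => by rw [(hAd t).deriv]; exact hcos t
  have hAle : ∀ t, A t ≤ A t₁ := by
    intro t
    rcases le_total t t₁ with h | h
    · exact hAmono h
    · have hzero : ∫ u in t₁..t, cos (Θ u) = 0 := by
        rw [intervalIntegral.integral_congr (g := fun _ => (0 : ℝ)), intervalIntegral.integral_zero]
        intro u hu
        rw [Set.uIcc_of_le h] at hu
        simp [hend u hu.1]
      have := intervalIntegral.integral_add_adjacent_intervals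
        (hcosΘ.continuous.intervalIntegrable (μ := MeasureTheory.volume) 0 t₁)
        (hcosΘ.continuous.intervalIntegrable t₁ t)
      simp only [hA]
      linarith
  set R : ℝ → ℝ := fun t => rbar * exp (-A t) with hR
  have hRsmooth : ContDiff ℝ (⊤ : ℕ∞) R := contDiff_const.mul (contDiff_exp.comp hAsmooth.neg)
  have hRpos : ∀ t, 0 < R t := fun t => by positivity
  have hRd : ∀ t, HasDerivAt R (-(R t * cos (Θ t))) t := fun t => by
    refine ((hAd t).neg.exp.const_mul rbar).congr_deriv ?_
    simp only [hR, Pi.neg_apply]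
    ring
  have hRlow : ∀ t, R t₁ ≤ R t := fun t => by
    simp only [hR]
    have := hAle t
    gcongr
  have hSd : ∀ t, HasDerivAt (fun t => ∫ u in (0 : ℝ)..t, R u) (R t) t := fun t =>
    (hRsmooth.continuous.integral_hasStrictDerivAt 0 t).hasDerivAt
  obtain ⟨σ, hσ, hσmono, hσS, hSσ⟩ :=
    exists_contDiff_inverse (hRpos t₁) (contDiff_primitive hRsmooth 0) hSd hRlow
  have hσ0 : σ 0 = 0 := by simpa using hσS 0
  have hσd : ∀ s, HasDerivAt σ (R (σ s))⁻¹ s := fun s =>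
    HasDerivAt.of_local_left_inverse hσ.continuous.continuousAt (hSd (σ s)) (hRpos _).ne'
      (Filter.Eventually.of_forall hSσ)
  have hradius : ∀ s, rbar - ∫ u in (0 : ℝ)..s, cos (Θ (σ u)) = R (σ s) := by
    intro s
    have hd : ∀ u ∈ Set.uIcc 0 s, HasDerivAt (fun u => -R (σ u)) (cos (Θ (σ u))) u := by
      intro u _
      refine ((hRd (σ u)).comp u (hσd u)).neg.congr_deriv ?_
      field_simp [(hRpos (σ u)).ne']
    rw [intervalIntegral.integral_eq_sub_of_hasDerivAt hd
      ((hcosΘ.continuous.comp hσ.continuous).intervalIntegrable _ _)]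
    simp [hσ0, hR, hA]
  refine ⟨σ, hσ, hσmono, fun t => ⟨_, hσS t⟩, hσ0, fun s => ?_⟩
  have hθd : HasDerivAt (fun s => Θ (σ s)) (deriv Θ (σ s) * (R (σ s))⁻¹) s :=
    ((contDiff_infty_iff_deriv.1 hΘ).1 _).hasDerivAt.comp s (hσd s)
  rw [hradius, hθd.deriv]
  exact ⟨hRpos _, inv_mul_cancel_right₀ (hRpos _).ne' _⟩

/-- core of the second bend, Lemma 4.11: for every `c > 0`, `r̄ > 0` and
`θ₀ ∈ (0, π/2)` there are `b > 0` and a smooth non-decreasing function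
`θ : [0, b] → [0, π/2]` with `θ ≡ θ₀` near `0`, `θ ≡ π/2` near `b`, such that
`r(s) = r̄ − ∫₀^s cos θ` stays positive and the bending inequality
`θ'(s)·r(s) ≤ c·sin θ(s)` holds on `[0, b]`. -/
theorem stmt15 (c rbar θ₀ : ℝ) (hc : 0 < c) (hrbar : 0 < rbar)
    (hθ₀ : θ₀ ∈ Set.Ioo 0 (π / 2)) :
    ∃ b : ℝ, 0 < b ∧ ∃ θ : ℝ → ℝ, ContDiff ℝ (⊤ : ℕ∞) θ ∧
      MonotoneOn θ (Set.Icc 0 b) ∧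
      (∀ s ∈ Set.Icc 0 b, θ s ∈ Set.Icc 0 (π / 2)) ∧
      (∀ᶠ s in nhds 0, θ s = θ₀) ∧
      (∀ᶠ s in nhds b, θ s = π / 2) ∧
      (∀ s ∈ Set.Icc 0 b, 0 < rbar - ∫ u in (0 : ℝ)..s, Real.cos (θ u)) ∧
      (∀ s ∈ Set.Icc 0 b,
        deriv θ s * (rbar - ∫ u in (0 : ℝ)..s, Real.cos (θ u)) ≤ c * Real.sin (θ s)) := by
  obtain ⟨h0, h1⟩ := hθ₀
  have hsin : 0 < sin θ₀ := sin_pos_of_pos_of_lt_pi h0 (by linarith [pi_pos])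
  obtain ⟨T, hT, Θ, hΘ, hmono, hrange, hstart, hend, hslope⟩ :=
    exists_slow_transition h1.le (mul_pos hc hsin)
  have hcos : ∀ t, 0 ≤ cos (Θ t) := fun t =>
    cos_nonneg_of_mem_Icc ⟨by linarith [(hrange t).1, pi_pos], (hrange t).2⟩
  obtain ⟨σ, hσ, hσmono, hσsurj, hσ0, hrad⟩ :=
    exists_arcLength_reparametrization hrbar hΘ hcos hend
  obtain ⟨b, hb⟩ := hσsurj (3 * T)
  refine ⟨b, hσmono.lt_iff_lt.1 (by rw [hσ0, hb]; positivity), fun s => Θ (σ s), hΘ.comp hσ,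
    (hmono.comp hσmono.monotone).monotoneOn _, fun s _ => ⟨h0.le.trans (hrange _).1, (hrange _).2⟩,
    ?_, ?_, fun s _ => (hrad s).1, fun s hs => ?_⟩
  · filter_upwards [hσ.continuous.continuousAt.eventually_lt continuousAt_const
      (show σ 0 < T by rwa [hσ0])] with s hs
    exact hstart _ hs.le
  · filter_upwards [continuousAt_const.eventually_lt hσ.continuous.continuousAt
      (show 2 * T < σ b by rw [hb]; linarith)] with s hs
    exact hend _ hs.le
  · rw [(hrad s).2]
    have hmem : σ s ∈ Set.Icc 0 (3 * T) :=
      ⟨hσ0 ▸ hσmono.monotone hs.1, hb ▸ hσmono.monotone hs.2⟩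
    refine (hslope _ hmem).trans (mul_le_mul_of_nonneg_left ?_ hc.le)
    exact sin_le_sin_of_le_of_le_pi_div_two (by linarith [pi_pos]) (hrange _).2 (hrange _).1
end

section
/- Let r̄ > 0, c > 0 and 0 ≤ s₃ < s₄ < b. Let κ: [0,b] → ℝ be continuous with κ(s) ≥ 0 for all s ∈ [s₃,b], and define θ(s) := ∫₀^s κ(u) du and r(s) := r̄ − ∫₀^s cos(θ(u)) du. Assume 0 ≤ θ(s) ≤ π/2 for all s ∈ [0,b], θ(s₃) > 0, and κ(s)·r(s) ≤ (c/3)·sin(θ(s)) for all s ∈ [s₃,b]. Then there exists δ ∈ (0, b − s₄) such that for every s• ∈ [s₃, s₄] and every continuous η: [0,b] → [0,1] with η ≡ 1 on [0, s•] and η ≡ 0 on [s• + δ, b], the functions θ̃(s) := ∫₀^s η(u)κ(u) du and r̃(s) := r̄ − ∫₀^s cos(θ̃(u)) du satisfy η(s)·κ(s)·r̃(s) ≤ (c/2)·sin(θ̃(s)) for all s ∈ [s₃,b]. -/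
open Real

noncomputable section

/-- The angular function `θ(s) = ∫₀^s κ` determined by a curvature function `κ`. -/
def angOf (κ : ℝ → ℝ) (s : ℝ) : ℝ := ∫ u in (0 : ℝ)..s, κ u

/-- The first coordinate `r(s) = r̄ − ∫₀^s cos θ` of the curve determined by `κ`. -/
def radOf (rbar : ℝ) (κ : ℝ → ℝ) (s : ℝ) : ℝ :=
  rbar - ∫ u in (0 : ℝ)..s, Real.cos (angOf κ u)

theorem intervalIntegrable_of_continuousOn_Icc_zero {f : ℝ → ℝ} {b x y : ℝ}
    (hf : ContinuousOn f (Set.Icc 0 b)) (hx : 0 ≤ x) (hxy : x ≤ y) (hy : y ≤ b) :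
    IntervalIntegrable f MeasureTheory.volume x y :=
  (hf.mono (Set.Icc_subset_Icc hx hy)).intervalIntegrable_of_Icc hxy

theorem continuousOn_angOf {f : ℝ → ℝ} {b : ℝ} (hb : 0 ≤ b)
    (hf : ContinuousOn f (Set.Icc 0 b)) : ContinuousOn (angOf f) (Set.Icc 0 b) := by
  have h := intervalIntegral.continuousOn_primitive_interval (μ := MeasureTheory.volume)
    (f := f) (a := 0) (b := b) (by
      rw [Set.uIcc_of_le hb]
      exact hf.integrableOn_Icc)
  rwa [Set.uIcc_of_le hb] at h

theorem angOf_congr {f g : ℝ → ℝ} {a s : ℝ} (hs : 0 ≤ s) (hsa : s ≤ a)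
    (hfg : ∀ u ∈ Set.Icc 0 a, g u = f u) : angOf g s = angOf f s := by
  refine intervalIntegral.integral_congr fun u hu => ?_
  rw [Set.uIcc_of_le hs] at hu
  exact hfg u ⟨hu.1, hu.2.trans hsa⟩

theorem angOf_add_integral {f : ℝ → ℝ} {a b s : ℝ} (hf : ContinuousOn f (Set.Icc 0 b))
    (ha : 0 ≤ a) (has : a ≤ s) (hsb : s ≤ b) : angOf f a + ∫ u in a..s, f u = angOf f s :=
  intervalIntegral.integral_add_adjacent_intervals
    (intervalIntegrable_of_continuousOn_Icc_zero hf le_rfl ha (has.trans hsb))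
    (intervalIntegrable_of_continuousOn_Icc_zero hf ha has hsb)

theorem angOf_le_angOf_of_nonneg {f : ℝ → ℝ} {a b s : ℝ} (hf : ContinuousOn f (Set.Icc 0 b))
    (ha : 0 ≤ a) (has : a ≤ s) (hsb : s ≤ b) (hnn : ∀ u ∈ Set.Icc a b, 0 ≤ f u) :
    angOf f a ≤ angOf f s := by
  rw [← angOf_add_integral hf ha has hsb]
  exact le_add_of_nonneg_right <| intervalIntegral.integral_nonneg has
    fun u hu => hnn u ⟨hu.1, hu.2.trans hsb⟩

theorem angOf_le_angOf_of_le {f g : ℝ → ℝ} {b s : ℝ} (hf : ContinuousOn f (Set.Icc 0 b))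
    (hg : ContinuousOn g (Set.Icc 0 b)) (hs : 0 ≤ s) (hsb : s ≤ b)
    (hgf : ∀ u ∈ Set.Icc 0 b, g u ≤ f u) : angOf g s ≤ angOf f s :=
  intervalIntegral.integral_mono_on hs
    (intervalIntegrable_of_continuousOn_Icc_zero hg le_rfl hs hsb)
    (intervalIntegrable_of_continuousOn_Icc_zero hf le_rfl hs hsb)
    fun u hu => hgf u ⟨hu.1, hu.2.trans hsb⟩

theorem angOf_sub_angOf_le {f g : ℝ → ℝ} {a b s M : ℝ} (hf : ContinuousOn f (Set.Icc 0 b))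
    (hg : ContinuousOn g (Set.Icc 0 b)) (ha : 0 ≤ a) (has : a ≤ s) (hsb : s ≤ b)
    (hfg : ∀ u ∈ Set.Icc 0 a, g u = f u) (hg0 : ∀ u ∈ Set.Icc a b, 0 ≤ g u)
    (hfM : ∀ u ∈ Set.Icc 0 b, f u ≤ M) : angOf f s - angOf g s ≤ M * (s - a) := by
  have hint : ∫ u in a..s, f u ≤ ∫ _ in a..s, M :=
    intervalIntegral.integral_mono_on has
      (intervalIntegrable_of_continuousOn_Icc_zero hf ha has hsb) (by simp)
      fun u hu => hfM u ⟨ha.trans hu.1, hu.2.trans hsb⟩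
  rw [intervalIntegral.integral_const, smul_eq_mul] at hint
  have hmono := angOf_le_angOf_of_nonneg hg ha has hsb hg0
  rw [angOf_congr ha le_rfl hfg] at hmono
  linarith [angOf_add_integral hf ha has hsb]

theorem radOf_le_radOf {f g : ℝ → ℝ} {b s : ℝ} (rbar : ℝ) (hf : ContinuousOn f (Set.Icc 0 b))
    (hg : ContinuousOn g (Set.Icc 0 b)) (hs : 0 ≤ s) (hsb : s ≤ b)
    (hg0 : ∀ u ∈ Set.Icc 0 b, 0 ≤ angOf g u) (hgf : ∀ u ∈ Set.Icc 0 b, angOf g u ≤ angOf f u)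
    (hfπ : ∀ u ∈ Set.Icc 0 b, angOf f u ≤ π) : radOf rbar g s ≤ radOf rbar f s := by
  have hb := hs.trans hsb
  refine sub_le_sub_left (intervalIntegral.integral_mono_on hs
    (intervalIntegrable_of_continuousOn_Icc_zero
      (Real.continuous_cos.comp_continuousOn (continuousOn_angOf hb hf)) le_rfl hs hsb)
    (intervalIntegrable_of_continuousOn_Icc_zero
      (Real.continuous_cos.comp_continuousOn (continuousOn_angOf hb hg)) le_rfl hs hsb)
    fun u hu => ?_) _
  have hu' : u ∈ Set.Icc 0 b := ⟨hu.1, hu.2.trans hsb⟩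
  exact Real.cos_le_cos_of_nonneg_of_le_pi (hg0 u hu') (hfπ u hu') (hgf u hu')

theorem sin_sub_sin_le_sub {x y : ℝ} (hxy : x ≤ y) : Real.sin y - Real.sin x ≤ y - x := by
  have h := (le_abs_self _).trans (Real.abs_sin_sub_sin_le y x)
  rwa [abs_of_nonneg (sub_nonneg.2 hxy)] at h

/-- analytic content of Lemma 4.15: cutting off the curvature function `κ`
of a bending curve by a `δ`-cutoff at any point `s• ∈ [s₃, s₄]` preserves the bending
inequality, with the constant `c/3` worsened only to `c/2`, uniformly in `s•`. -/
theorem stmt16 (rbar c s₃ s₄ b : ℝ) (hrbar : 0 < rbar) (hc : 0 < c)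
    (hs₃ : 0 ≤ s₃) (hs₃₄ : s₃ < s₄) (hs₄b : s₄ < b)
    (κ : ℝ → ℝ) (hκc : ContinuousOn κ (Set.Icc 0 b))
    (hκnn : ∀ s ∈ Set.Icc s₃ b, 0 ≤ κ s)
    (hang : ∀ s ∈ Set.Icc 0 b, angOf κ s ∈ Set.Icc 0 (π / 2))
    (hpos : 0 < angOf κ s₃)
    (hineq : ∀ s ∈ Set.Icc s₃ b, κ s * radOf rbar κ s ≤ c / 3 * Real.sin (angOf κ s)) :
    ∃ δ : ℝ, 0 < δ ∧ δ < b - s₄ ∧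
      ∀ sc ∈ Set.Icc s₃ s₄, ∀ η : ℝ → ℝ, ContinuousOn η (Set.Icc 0 b) →
        (∀ s ∈ Set.Icc 0 b, η s ∈ Set.Icc (0 : ℝ) 1) →
        (∀ s ∈ Set.Icc 0 sc, η s = 1) →
        (∀ s ∈ Set.Icc (sc + δ) b, η s = 0) →
        ∀ s ∈ Set.Icc s₃ b,
          η s * κ s * radOf rbar (fun u => η u * κ u) s ≤
            c / 2 * Real.sin (angOf (fun u => η u * κ u) s) := by
  have hb : 0 < b := by linarith
  have hs₃b : s₃ ≤ b := by linarith
  have hsin₃ : 0 < Real.sin (angOf κ s₃) :=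
    Real.sin_pos_of_pos_of_lt_pi hpos (by linarith [(hang s₃ ⟨hs₃, hs₃b⟩).2, Real.pi_pos])
  obtain ⟨C, hC⟩ := isCompact_Icc.exists_bound_of_continuousOn hκc
  set M := max C 1
  have hM : 0 < M := lt_max_of_lt_right one_pos
  have hκM : ∀ u ∈ Set.Icc 0 b, κ u ≤ M := fun u hu =>
    (le_abs_self _).trans ((hC u hu).trans (le_max_left _ _))
  refine ⟨min ((b - s₄) / 2) (Real.sin (angOf κ s₃) / (2 * M)),
    lt_min (by linarith) (by positivity), (min_le_left _ _).trans_lt (by linarith), ?_⟩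
  set δ := min ((b - s₄) / 2) (Real.sin (angOf κ s₃) / (2 * M))
  have hMδ : M * δ ≤ Real.sin (angOf κ s₃) / 2 := by
    calc M * δ ≤ M * (Real.sin (angOf κ s₃) / (2 * M)) := by gcongr; exact min_le_right _ _
      _ = Real.sin (angOf κ s₃) / 2 := by field_simp
  intro sc hsc η hηc hη01 hη1 hη0 s hs
  have hsc0 : 0 ≤ sc := hs₃.trans hsc.1
  have hscb : sc ≤ b := hsc.2.trans hs₄b.le
  have hs0 : 0 ≤ s := hs₃.trans hs.1
  set g : ℝ → ℝ := fun u => η u * κ u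
  have hgc : ContinuousOn g (Set.Icc 0 b) := hηc.mul hκc
  have hgeq : ∀ u ∈ Set.Icc 0 sc, g u = κ u := fun u hu => by simp [g, hη1 u hu]
  have hg0 : ∀ u ∈ Set.Icc s₃ b, 0 ≤ g u := fun u hu =>
    mul_nonneg (hη01 u ⟨hs₃.trans hu.1, hu.2⟩).1 (hκnn u hu)
  have hgκ : ∀ u ∈ Set.Icc 0 b, g u ≤ κ u := fun u hu => by
    rcases le_total u sc with h | h
    · exact (hgeq u ⟨hu.1, h⟩).le
    · exact mul_le_of_le_one_left (hκnn u ⟨hsc.1.trans h, hu.2⟩) (hη01 u hu).2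
  have hle : ∀ u ∈ Set.Icc 0 b, angOf g u ≤ angOf κ u := fun u hu =>
    angOf_le_angOf_of_le hκc hgc hu.1 hu.2 hgκ
  have hlow : ∀ u ∈ Set.Icc s₃ b, angOf κ s₃ ≤ angOf g u := fun u hu => by
    rw [← angOf_congr hs₃ hsc.1 hgeq]
    exact angOf_le_angOf_of_nonneg hgc hs₃ hu.1 hu.2 hg0
  have hnonneg : ∀ u ∈ Set.Icc 0 b, 0 ≤ angOf g u := fun u hu => by
    rcases le_total u s₃ with h | h
    · rw [angOf_congr hu.1 (h.trans hsc.1) hgeq]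
      exact (hang u hu).1
    · exact hpos.le.trans (hlow u ⟨h, hu.2⟩)
  have hs' : s ∈ Set.Icc 0 b := ⟨hs0, hs.2⟩
  have hθ := (hang s hs').2
  have hsin : Real.sin (angOf κ s₃) ≤ Real.sin (angOf g s) :=
    Real.sin_le_sin_of_le_of_le_pi_div_two (by linarith [Real.pi_pos])
      ((hle s hs').trans hθ) (hlow s hs)
  rcases le_or_gt (sc + δ) s with hfar | hnear
  · rw [hη0 s ⟨hfar, hs.2⟩]
    have := hsin₃.trans_le hsin
    simp only [zero_mul]
    positivity
  have hsin' : Real.sin (angOf κ s) - Real.sin (angOf g s) ≤ Real.sin (angOf κ s₃) / 2 := by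
    refine (sin_sub_sin_le_sub (hle s hs')).trans ?_
    rcases le_total s sc with h | h
    · rw [angOf_congr hs0 h hgeq]
      linarith
    · calc angOf κ s - angOf g s ≤ M * (s - sc) :=
            angOf_sub_angOf_le hκc hgc hsc0 h hs.2 hgeq
              (fun u hu => hg0 u ⟨hsc.1.trans hu.1, hu.2⟩) hκM
        _ ≤ M * δ := by gcongr; linarith
        _ ≤ _ := hMδ
  have hsinκ : 0 ≤ Real.sin (angOf κ s) :=
    Real.sin_nonneg_of_nonneg_of_le_pi (hang s hs').1 (by linarith [Real.pi_pos])
  calc η s * κ s * radOf rbar g s ≤ η s * κ s * radOf rbar κ s :=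
        mul_le_mul_of_nonneg_left (radOf_le_radOf rbar hκc hgc hs0 hs.2 hnonneg hle
          fun u hu => by linarith [(hang u hu).2, Real.pi_pos]) (hg0 s hs)
    _ = η s * (κ s * radOf rbar κ s) := mul_assoc _ _ _
    _ ≤ η s * (c / 3 * Real.sin (angOf κ s)) :=
        mul_le_mul_of_nonneg_left (hineq s hs) (hη01 s hs').1
    _ ≤ c / 3 * Real.sin (angOf κ s) :=
        mul_le_of_le_one_left (by positivity) (hη01 s hs').2
    _ ≤ c / 3 * (3 / 2 * Real.sin (angOf g s)) := by gcongr; linarith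
    _ = c / 2 * Real.sin (angOf g s) := by ring
end
end

section
/- Let C₁ ∈ (0,1], t* > 0, and let a, b be real numbers with 0 < a < b < t*/2. Then there exist C₂ ∈ (0,1), a continuous function e: [0,1] → (0,∞), and a continuous map φ: [0,1] × ℝ → ℝ such that for every s ∈ [0,1] the function φ_s := φ(s,·) is a smooth strictly increasing bijection of ℝ and, writing c_s := φ_s⁻¹(8t*/10) and d_s := φ_s⁻¹(9t*/10), one has b < c_s < d_s < e(s) and: (i) φ₀ = id; (ii) φ_s(0) = 0 and φ_s(e(s)) = t*; (iii) φ_s' ≡ 1 on (−∞, a] ∪ [d_s, ∞), and φ_s' ≡ 1 − s·C₂ on [b, c_s] with all derivatives of φ_s of order ≥ 2 vanishing on [b, c_s]; (iv) 1 − C₂ ≤ φ_s'(u) ≤ 1 for all u ∈ ℝ; (v) φ_s''(u) ≤ C₁ for all u ∈ ℝ; (vi) φ_s'' ≤ 0 on [a, b] and φ_s'' ≥ 0 on [c_s, d_s]. -/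
open Real in
/-- The primitive of `Real.smoothTransition` vanishing at `0`: a smooth convex function equal to
`0` on `(-∞, 0]` and affine of slope `1` on `[1, ∞)`. -/
noncomputable def smoothRamp (x : ℝ) : ℝ := ∫ t in (0 : ℝ)..x, smoothTransition t

namespace smoothRamp

open Real

theorem hasDerivAt (x : ℝ) : HasDerivAt smoothRamp (smoothTransition x) x :=
  (smoothTransition.continuous.integral_hasStrictDerivAt 0 x).hasDerivAt

theorem deriv_eq : deriv smoothRamp = smoothTransition :=
  funext fun x => (hasDerivAt x).deriv

theorem contDiff : ContDiff ℝ (⊤ : ℕ∞) smoothRamp := by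
  refine contDiff_infty_iff_deriv.2 ⟨fun x => (hasDerivAt x).differentiableAt, ?_⟩
  rw [deriv_eq]
  exact smoothTransition.contDiff

theorem of_nonpos {x : ℝ} (hx : x ≤ 0) : smoothRamp x = 0 := by
  rw [smoothRamp, intervalIntegral.integral_congr (g := fun _ => (0 : ℝ))]
  · simp
  · intro t ht
    rw [Set.uIcc_of_ge hx] at ht
    exact smoothTransition.zero_of_nonpos ht.2

theorem of_one_le {x : ℝ} (hx : 1 ≤ x) : smoothRamp x = x - 1 + smoothRamp 1 := by
  have h : ∫ t in (1 : ℝ)..x, smoothTransition t = x - 1 := by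
    rw [intervalIntegral.integral_congr (g := fun _ => (1 : ℝ))]
    · simp
    · intro t ht
      rw [Set.uIcc_of_le hx] at ht
      exact smoothTransition.one_of_one_le ht.1
  have hi (p q : ℝ) : IntervalIntegrable smoothTransition MeasureTheory.volume p q :=
    smoothTransition.continuous.intervalIntegrable p q
  rw [smoothRamp, smoothRamp, ← intervalIntegral.integral_add_adjacent_intervals (hi 0 1) (hi 1 x),
    h, add_comm]

theorem one_nonneg : 0 ≤ smoothRamp 1 :=
  intervalIntegral.integral_nonneg zero_le_one fun t _ => smoothTransition.nonneg t

theorem one_le_one : smoothRamp 1 ≤ 1 := by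
  have := intervalIntegral.integral_mono_on (μ := MeasureTheory.volume) zero_le_one
    (smoothTransition.continuous.intervalIntegrable (0 : ℝ) 1)
    (continuous_const.intervalIntegrable (0 : ℝ) 1) fun t _ => smoothTransition.le_one t
  simpa [smoothRamp] using this

end smoothRamp

namespace Real.smoothTransition

theorem deriv_nonneg (x : ℝ) : 0 ≤ deriv smoothTransition x :=
  smoothTransition.monotone.deriv_nonneg

theorem deriv_of_nonpos {x : ℝ} (hx : x ≤ 0) : deriv smoothTransition x = 0 := by
  refine IsLocalMin.deriv_eq_zero (Filter.Eventually.of_forall fun y => ?_)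
  rw [zero_of_nonpos hx]
  exact nonneg y

theorem deriv_of_one_le {x : ℝ} (hx : 1 ≤ x) : deriv smoothTransition x = 0 := by
  refine IsLocalMax.deriv_eq_zero (Filter.Eventually.of_forall fun y => ?_)
  rw [one_of_one_le hx]
  exact le_one y

theorem exists_deriv_le : ∃ M : ℝ, 0 < M ∧ ∀ x, deriv smoothTransition x ≤ M := by
  have hc : Continuous (deriv smoothTransition) :=
    (smoothTransition.contDiff (n := 1)).continuous_deriv le_rfl
  obtain ⟨M, hM⟩ := (isCompact_Icc (a := (0 : ℝ)) (b := 1)).bddAbove_image hc.continuousOn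
  refine ⟨max M 1, by positivity, fun x => ?_⟩
  rcases le_total x 0 with h0 | h0
  · rw [deriv_of_nonpos h0]; positivity
  rcases le_total 1 x with h1 | h1
  · rw [deriv_of_one_le h1]; positivity
  exact (hM ⟨x, ⟨h0, h1⟩, rfl⟩).trans (le_max_left _ _)

end Real.smoothTransition

/-- A reparametrization of `ℝ` of slope `1` outside `[a, d]`, of slope `1 - k` on `[b, c]`, and
interpolating smoothly and monotonically between the two slopes on `[a, b]` and `[c, d]`. -/
noncomputable def slopeDip (k a b c d u : ℝ) : ℝ :=
  u - k * ((b - a) * smoothRamp ((u - a) / (b - a)) - (d - c) * smoothRamp ((u - c) / (d - c)))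

namespace slopeDip

open Real Filter

variable {k a b c d u : ℝ}

theorem hasDerivAt (hab : a < b) (hcd : c < d) (u : ℝ) :
    HasDerivAt (slopeDip k a b c d)
      (1 - k * (smoothTransition ((u - a) / (b - a)) - smoothTransition ((u - c) / (d - c)))) u := by
  have key (p q : ℝ) (h : p < q) : HasDerivAt (fun u => (q - p) * smoothRamp ((u - p) / (q - p)))
      (smoothTransition ((u - p) / (q - p))) u := by
    have hq : q - p ≠ 0 := (sub_pos.2 h).ne'
    have h1 : HasDerivAt (fun u : ℝ => (u - p) / (q - p)) (1 / (q - p)) u :=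
      ((hasDerivAt_id u).sub_const p).div_const (q - p)
    refine (((smoothRamp.hasDerivAt _).comp u h1).const_mul (q - p)).congr_deriv ?_
    field_simp
  exact (hasDerivAt_id u).sub (((key a b hab).sub (key c d hcd)).const_mul k)

theorem deriv_eq (hab : a < b) (hcd : c < d) (u : ℝ) :
    deriv (slopeDip k a b c d) u =
      1 - k * (smoothTransition ((u - a) / (b - a)) - smoothTransition ((u - c) / (d - c))) :=
  (hasDerivAt hab hcd u).deriv

theorem iteratedDeriv_two_eq (hab : a < b) (hcd : c < d) (u : ℝ) :
    iteratedDeriv 2 (slopeDip k a b c d) u =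
      k * (deriv smoothTransition ((u - c) / (d - c)) / (d - c) -
        deriv smoothTransition ((u - a) / (b - a)) / (b - a)) := by
  have key (p q : ℝ) : HasDerivAt (fun u => smoothTransition ((u - p) / (q - p)))
      (deriv smoothTransition ((u - p) / (q - p)) / (q - p)) u := by
    have h1 : HasDerivAt (fun u : ℝ => (u - p) / (q - p)) (1 / (q - p)) u :=
      ((hasDerivAt_id u).sub_const p).div_const (q - p)
    have h2 : HasDerivAt smoothTransition (deriv smoothTransition ((u - p) / (q - p)))
        ((u - p) / (q - p)) :=
      ((smoothTransition.contDiff (n := 1)).differentiable one_ne_zero _).hasDerivAt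
    exact (h2.comp u h1).congr_deriv (by rw [mul_one_div])
  rw [iteratedDeriv_succ, iteratedDeriv_one, funext (deriv_eq hab hcd)]
  refine ((((key a b).sub (key c d)).const_mul k).const_sub 1).deriv.trans ?_
  ring

theorem contDiff : ContDiff ℝ (⊤ : ℕ∞) (slopeDip k a b c d) := by
  have key (p q : ℝ) : ContDiff ℝ (⊤ : ℕ∞) (fun u => smoothRamp ((u - p) / (q - p))) :=
    smoothRamp.contDiff.comp ((contDiff_id.sub contDiff_const).div_const _)
  exact contDiff_id.sub (contDiff_const.mul
    ((contDiff_const.mul (key a b)).sub (contDiff_const.mul (key c d))))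

theorem of_le_left (hab : a < b) (hbc : b < c) (hcd : c < d) (hu : u ≤ a) :
    slopeDip k a b c d u = u := by
  rw [slopeDip, smoothRamp.of_nonpos (div_nonpos_of_nonpos_of_nonneg (by linarith) (by linarith)),
    smoothRamp.of_nonpos (div_nonpos_of_nonpos_of_nonneg (by linarith) (by linarith))]
  ring

theorem of_mem_Icc (hab : a < b) (hcd : c < d) (hu : u ∈ Set.Icc b c) :
    slopeDip k a b c d u = u - k * ((b - a) * smoothRamp 1 + (u - b)) := by
  have hp : 0 < b - a := sub_pos.2 hab
  rw [slopeDip, smoothRamp.of_one_le ((one_le_div hp).2 (by linarith [hu.1])),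
    smoothRamp.of_nonpos (div_nonpos_of_nonpos_of_nonneg (by linarith [hu.2]) (by linarith))]
  field_simp
  ring

theorem of_right_le (hab : a < b) (hbc : b < c) (hcd : c < d) (hu : d ≤ u) :
    slopeDip k a b c d u =
      u - k * ((b - a) * smoothRamp 1 + (d - b) - (d - c) * smoothRamp 1) := by
  have hp : 0 < b - a := sub_pos.2 hab
  have hq : 0 < d - c := sub_pos.2 hcd
  rw [slopeDip, smoothRamp.of_one_le ((one_le_div hp).2 (by linarith)),
    smoothRamp.of_one_le ((one_le_div hq).2 (by linarith))]
  field_simp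
  ring

theorem deriv_of_le_left (hab : a < b) (hbc : b < c) (hcd : c < d) (hu : u ≤ a) :
    deriv (slopeDip k a b c d) u = 1 := by
  rw [deriv_eq hab hcd, smoothTransition.zero_of_nonpos
      (div_nonpos_of_nonpos_of_nonneg (by linarith) (by linarith)),
    smoothTransition.zero_of_nonpos (div_nonpos_of_nonpos_of_nonneg (by linarith) (by linarith))]
  ring

theorem deriv_of_mem_Icc (hab : a < b) (hcd : c < d) (hu : u ∈ Set.Icc b c) :
    deriv (slopeDip k a b c d) u = 1 - k := by
  rw [deriv_eq hab hcd,
    smoothTransition.one_of_one_le ((one_le_div (sub_pos.2 hab)).2 (by linarith [hu.1])),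
    smoothTransition.zero_of_nonpos
      (div_nonpos_of_nonpos_of_nonneg (by linarith [hu.2]) (by linarith))]
  ring

theorem deriv_of_right_le (hab : a < b) (hbc : b < c) (hcd : c < d) (hu : d ≤ u) :
    deriv (slopeDip k a b c d) u = 1 := by
  rw [deriv_eq hab hcd,
    smoothTransition.one_of_one_le ((one_le_div (sub_pos.2 hab)).2 (by linarith)),
    smoothTransition.one_of_one_le ((one_le_div (sub_pos.2 hcd)).2 (by linarith))]
  ring

theorem deriv_mem_Icc (hk : 0 ≤ k) (hab : a < b) (hbc : b < c) (hcd : c < d) (u : ℝ) :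
    deriv (slopeDip k a b c d) u ∈ Set.Icc (1 - k) 1 := by
  rw [deriv_eq hab hcd]
  have h1 := smoothTransition.le_one ((u - a) / (b - a))
  have h2 := smoothTransition.nonneg ((u - c) / (d - c))
  have h3 : smoothTransition ((u - c) / (d - c)) ≤ smoothTransition ((u - a) / (b - a)) := by
    rcases le_total u c with hu | hu
    · rw [smoothTransition.zero_of_nonpos
        (div_nonpos_of_nonpos_of_nonneg (by linarith) (by linarith))]
      exact smoothTransition.nonneg _
    · rw [smoothTransition.one_of_one_le (x := (u - a) / (b - a))
        ((one_le_div (sub_pos.2 hab)).2 (by linarith))]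
      exact smoothTransition.le_one _
  constructor <;> nlinarith

theorem iteratedDeriv_two_nonpos (hk : 0 ≤ k) (hab : a < b) (hcd : c < d) (hu : u ≤ c) :
    iteratedDeriv 2 (slopeDip k a b c d) u ≤ 0 := by
  rw [iteratedDeriv_two_eq hab hcd, smoothTransition.deriv_of_nonpos
    (div_nonpos_of_nonpos_of_nonneg (by linarith) (by linarith))]
  have := div_nonneg (smoothTransition.deriv_nonneg ((u - a) / (b - a))) (sub_pos.2 hab).le
  rw [zero_div]
  nlinarith

theorem iteratedDeriv_two_nonneg (hk : 0 ≤ k) (hab : a < b) (hcd : c < d) (hu : b ≤ u) :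
    0 ≤ iteratedDeriv 2 (slopeDip k a b c d) u := by
  rw [iteratedDeriv_two_eq hab hcd, smoothTransition.deriv_of_one_le (x := (u - a) / (b - a))
    ((one_le_div (sub_pos.2 hab)).2 (by linarith))]
  have := div_nonneg (smoothTransition.deriv_nonneg ((u - c) / (d - c))) (sub_pos.2 hcd).le
  rw [zero_div, sub_zero]
  positivity

theorem iteratedDeriv_two_le {M : ℝ} (hM : ∀ x, deriv smoothTransition x ≤ M) (hk : 0 ≤ k)
    (hab : a < b) (hcd : c < d) (u : ℝ) :
    iteratedDeriv 2 (slopeDip k a b c d) u ≤ k * (M / (d - c)) := by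
  rw [iteratedDeriv_two_eq hab hcd]
  have h1 := div_nonneg (smoothTransition.deriv_nonneg ((u - a) / (b - a))) (sub_pos.2 hab).le
  have h2 := div_le_div_of_nonneg_right (hM ((u - c) / (d - c))) (sub_pos.2 hcd).le
  exact mul_le_mul_of_nonneg_left (by linarith) hk

theorem iteratedDeriv_eq_zero (hab : a < b) (hbc : b < c) (hcd : c < d) {m : ℕ} (hm : 2 ≤ m)
    (hu : u ∈ Set.Icc b c) : iteratedDeriv m (slopeDip k a b c d) u = 0 := by
  have hcont : Continuous (iteratedDeriv m (slopeDip k a b c d)) :=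
    contDiff.continuous_iteratedDeriv m (by exact_mod_cast le_top)
  have hopen : Set.Ioo b c ⊆ {u | iteratedDeriv m (slopeDip k a b c d) u = 0} := by
    intro v hv
    obtain ⟨n, rfl⟩ : ∃ n, m = n + 1 := ⟨m - 1, by omega⟩
    have hev : deriv (slopeDip k a b c d) =ᶠ[nhds v] fun _ => 1 - k := by
      filter_upwards [Ioo_mem_nhds hv.1 hv.2] with w hw
      exact deriv_of_mem_Icc hab hcd ⟨hw.1.le, hw.2.le⟩
    rw [Set.mem_ofPred_eq, iteratedDeriv_succ', hev.iteratedDeriv_eq, iteratedDeriv_const,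
      if_neg (by omega)]
  have hclosed := closure_minimal hopen (isClosed_eq hcont continuous_const)
  rw [closure_Ioo hbc.ne] at hclosed
  exact hclosed hu

theorem strictMono (hk : 0 ≤ k) (hk1 : k < 1) (hab : a < b) (hbc : b < c) (hcd : c < d) :
    StrictMono (slopeDip k a b c d) :=
  strictMono_of_deriv_pos fun u => by linarith [(deriv_mem_Icc hk hab hbc hcd u).1]

theorem surjective (hab : a < b) (hbc : b < c) (hcd : c < d) :
    Function.Surjective (slopeDip k a b c d) := by
  refine contDiff.continuous.surjective ?_ ?_
  · refine (tendsto_atTop_add_const_right atTop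
      (-(k * ((b - a) * smoothRamp 1 + (d - b) - (d - c) * smoothRamp 1))) tendsto_id).congr' ?_
    filter_upwards [eventually_ge_atTop d] with u hu
    rw [of_right_le hab hbc hcd hu, id, ← sub_eq_add_neg]
  · refine tendsto_id.congr' ?_
    filter_upwards [eventually_le_atBot a] with u hu
    exact (of_le_left hab hbc hcd hu).symm

end slopeDip


/-- Lemma 5.6: the first family of radial reparametrizations. Given
`C₁ ∈ (0,1]`, `t* > 0` and `0 < a < b < t*/2`, there are `C₂ ∈ (0,1)`, a continuous
`e : [0,1] → (0,∞)` and a continuous isotopy `φ : [0,1] × ℝ → ℝ` through smooth strictly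
increasing bijections of `ℝ` with the listed properties (i)–(vi), where
`c_s = φ_s⁻¹(8t*/10)` and `d_s = φ_s⁻¹(9t*/10)`. -/
theorem stmt17 (C₁ tstar a b : ℝ) (hC₁ : C₁ ∈ Set.Ioc (0 : ℝ) 1) (htstar : 0 < tstar)
    (ha : 0 < a) (hab : a < b) (hb : b < tstar / 2) :
    ∃ C₂ : ℝ, C₂ ∈ Set.Ioo (0 : ℝ) 1 ∧
    ∃ e : ℝ → ℝ, ContinuousOn e (Set.Icc 0 1) ∧ (∀ s ∈ Set.Icc (0 : ℝ) 1, 0 < e s) ∧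
    ∃ φ : ℝ → ℝ → ℝ,
      ContinuousOn (fun p : ℝ × ℝ => φ p.1 p.2) (Set.Icc 0 1 ×ˢ (Set.univ : Set ℝ)) ∧
      (∀ u : ℝ, φ 0 u = u) ∧
      ∀ s ∈ Set.Icc (0 : ℝ) 1,
        ContDiff ℝ (⊤ : ℕ∞) (φ s) ∧ StrictMono (φ s) ∧ Function.Bijective (φ s) ∧
        ∃ cs ds : ℝ, φ s cs = 8 * tstar / 10 ∧ φ s ds = 9 * tstar / 10 ∧
          b < cs ∧ cs < ds ∧ ds < e s ∧
          φ s 0 = 0 ∧ φ s (e s) = tstar ∧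
          (∀ u ≤ a, deriv (φ s) u = 1) ∧ (∀ u, ds ≤ u → deriv (φ s) u = 1) ∧
          (∀ u ∈ Set.Icc b cs, deriv (φ s) u = 1 - s * C₂ ∧
            ∀ m : ℕ, 2 ≤ m → iteratedDeriv m (φ s) u = 0) ∧
          (∀ u : ℝ, 1 - C₂ ≤ deriv (φ s) u ∧ deriv (φ s) u ≤ 1) ∧
          (∀ u : ℝ, iteratedDeriv 2 (φ s) u ≤ C₁) ∧
          (∀ u ∈ Set.Icc a b, iteratedDeriv 2 (φ s) u ≤ 0) ∧
          (∀ u ∈ Set.Icc cs ds, 0 ≤ iteratedDeriv 2 (φ s) u) := by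
  obtain ⟨M, hM0, hM⟩ := Real.smoothTransition.exists_deriv_le
  have hC₁0 : 0 < C₁ := hC₁.1
  set K := smoothRamp 1
  have hK0 : 0 ≤ K := smoothRamp.one_nonneg
  have hK1 : K ≤ 1 := smoothRamp.one_le_one
  obtain ⟨C, hC0, hC2, hCM⟩ : ∃ C : ℝ, 0 < C ∧ C ≤ 1 / 2 ∧ C ≤ C₁ * (tstar / 10) / M :=
    ⟨min (1 / 2) (C₁ * (tstar / 10) / M), by positivity, min_le_left _ _, min_le_right _ _⟩
  have hk0 : ∀ s ∈ Set.Icc (0 : ℝ) 1, 0 ≤ s * C := fun s hs => mul_nonneg hs.1 hC0.le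
  have hkC : ∀ s ∈ Set.Icc (0 : ℝ) 1, s * C ≤ C := fun s hs =>
    mul_le_of_le_one_left hC0.le hs.2
  have hden1 : ∀ s ∈ Set.Icc (0 : ℝ) 1, 0 < 1 - s * C := fun s hs => by linarith [hkC s hs]
  have hden2 : ∀ s ∈ Set.Icc (0 : ℝ) 1, 0 < 1 - s * C * (1 - K) := fun s hs => by
    nlinarith [hkC s hs, hk0 s hs]
  set c : ℝ → ℝ := fun s => (8 * tstar / 10 - s * C * (b - (b - a) * K)) / (1 - s * C)
  set w : ℝ → ℝ := fun s => (tstar / 10) / (1 - s * C * (1 - K))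
  have hccont : ContinuousOn c (Set.Icc 0 1) :=
    ContinuousOn.div (by fun_prop) (by fun_prop) fun s hs => (hden1 s hs).ne'
  have hwcont : ContinuousOn w (Set.Icc 0 1) :=
    ContinuousOn.div (by fun_prop) (by fun_prop) fun s hs => (hden2 s hs).ne'
  have hw_ge : ∀ s ∈ Set.Icc (0 : ℝ) 1, tstar / 10 ≤ w s := fun s hs => by
    refine (le_div_iff₀ (hden2 s hs)).2 ?_
    have := mul_nonneg (hk0 s hs) (sub_nonneg.2 hK1)
    nlinarith
  have hw_pos : ∀ s ∈ Set.Icc (0 : ℝ) 1, 0 < w s := fun s hs => by linarith [hw_ge s hs]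
  have hbc : ∀ s ∈ Set.Icc (0 : ℝ) 1, b < c s := fun s hs => by
    refine (lt_div_iff₀ (hden1 s hs)).2 ?_
    have := mul_nonneg (hk0 s hs) (mul_nonneg (sub_pos.2 hab).le hK0)
    nlinarith
  refine ⟨C, ⟨hC0, by linarith⟩, fun s => c s + w s + tstar / 10,
    (hccont.add hwcont).add continuousOn_const, fun s hs => ?_,
    fun s u => slopeDip (s * C) a b (c s) (c s + w s) u, ?_, fun u => by simp [slopeDip],
    fun s hs => ?_⟩
  · linarith [hbc s hs, hw_pos s hs]
  · have hs1 : ContinuousOn (fun p : ℝ × ℝ => c p.1) (Set.Icc 0 1 ×ˢ Set.univ) :=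
      hccont.comp continuousOn_fst fun p hp => hp.1
    have hs2 : ContinuousOn (fun p : ℝ × ℝ => w p.1) (Set.Icc 0 1 ×ˢ Set.univ) :=
      hwcont.comp continuousOn_fst fun p hp => hp.1
    have hramp : Continuous smoothRamp := smoothRamp.contDiff.continuous
    have h1 : Continuous fun p : ℝ × ℝ => (b - a) * smoothRamp ((p.2 - a) / (b - a)) := by
      fun_prop
    have h2 : ContinuousOn (fun p : ℝ × ℝ => w p.1 * smoothRamp ((p.2 - c p.1) / w p.1))
        (Set.Icc 0 1 ×ˢ Set.univ) :=
      hs2.mul (hramp.comp_continuousOn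
        ((continuousOn_snd.sub hs1).div hs2 fun p hp => (hw_pos p.1 hp.1).ne'))
    simp only [slopeDip, add_sub_cancel_left]
    exact continuousOn_snd.sub
      ((continuousOn_fst.mul continuousOn_const).mul (h1.continuousOn.sub h2))
  · have hk := hk0 s hs
    have hbc := hbc s hs
    have hcd : c s < c s + w s := lt_add_of_pos_right _ (hw_pos s hs)
    have hmono := slopeDip.strictMono hk (by linarith [hden1 s hs]) hab hbc hcd
    have hcval : c s * (1 - s * C) = 8 * tstar / 10 - s * C * (b - (b - a) * K) :=
      div_mul_cancel₀ _ (hden1 s hs).ne'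
    have hwval : w s * (1 - s * C * (1 - K)) = tstar / 10 :=
      div_mul_cancel₀ _ (hden2 s hs).ne'
    refine ⟨slopeDip.contDiff, hmono, ⟨hmono.injective, slopeDip.surjective hab hbc hcd⟩,
      c s, c s + w s, ?_, ?_, hbc, hcd, by linarith, slopeDip.of_le_left hab hbc hcd ha.le, ?_,
      fun u hu => slopeDip.deriv_of_le_left hab hbc hcd hu,
      fun u hu => slopeDip.deriv_of_right_le hab hbc hcd hu,
      fun u hu => ⟨slopeDip.deriv_of_mem_Icc hab hcd hu,
        fun m hm => slopeDip.iteratedDeriv_eq_zero hab hbc hcd hm hu⟩,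
      fun u => ?_, fun u => ?_,
      fun u hu => slopeDip.iteratedDeriv_two_nonpos hk hab hcd (hu.2.trans hbc.le),
      fun u hu => slopeDip.iteratedDeriv_two_nonneg hk hab hcd (hbc.le.trans hu.1)⟩
    · refine (slopeDip.of_mem_Icc hab hcd ⟨hbc.le, le_rfl⟩).trans ?_
      linear_combination hcval
    · refine (slopeDip.of_right_le hab hbc hcd le_rfl).trans ?_
      linear_combination hcval + hwval
    · refine (slopeDip.of_right_le hab hbc hcd (le_add_of_nonneg_right (by positivity))).trans ?_
      linear_combination hcval + hwval
    · obtain ⟨h1, h2⟩ := slopeDip.deriv_mem_Icc hk hab hbc hcd u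
      exact ⟨by linarith [hkC s hs], h2⟩
    · refine (slopeDip.iteratedDeriv_two_le hM hk hab hcd u).trans ?_
      rw [add_sub_cancel_left, ← mul_div_assoc, div_le_iff₀ (hw_pos s hs)]
      calc s * C * M ≤ C * M := mul_le_mul_of_nonneg_right (hkC s hs) hM0.le
        _ ≤ C₁ * (tstar / 10) := (le_div_iff₀ hM0).1 hCM
        _ ≤ C₁ * w s := mul_le_mul_of_nonneg_left (hw_ge s hs) hC₁0.le
end

section
/- Let D₁ ∈ (0,1] and t** > 0. Then there exist b̄ ∈ (0, t**/2), a continuous function ē: [0,1] → (0,∞), and a continuous map ψ: [0,1] × ℝ → ℝ such that for every s ∈ [0,1] the function ψ_s := ψ(s,·) is smooth, non-decreasing and surjective, ψ_s is strictly increasing for every s ∈ [0,1), and, writing ā := b̄/10 and c̄_s := inf{u ∈ ℝ : ψ_s(u) = 9t**/10}, one has ā < b̄ < c̄_s < ē(s) and: (i) ψ₀ = id; (ii) ψ_s(0) = 0 and ψ_s(ē(s)) = t**; (iii) 0 ≤ ψ_s'(u) ≤ 1 for all u ∈ ℝ; (iv) ψ_s' ≡ 1 on (−∞, ā] ∪ [ē(s),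 ∞); (v) ψ_s''(u) ≤ D₁/u for all u > 0; (vi) the n-th derivative ψ₁⁽ⁿ⁾(b̄) = 0 for every n ≥ 1. -/
open Real Set Filter Topology

/-- The derivative of `Real.smoothTransition` is bounded. -/
theorem exists_deriv_smoothTransition_le :
    ∃ K : ℝ, 0 < K ∧ ∀ x, deriv smoothTransition x ≤ K := by
  have hc : Continuous (deriv smoothTransition) :=
    (smoothTransition.contDiff (n := 1)).continuous_deriv le_rfl
  obtain ⟨K, hK⟩ := (isCompact_Icc (a := (0 : ℝ)) (b := 1)).bddAbove_image hc.continuousOn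
  refine ⟨max K 1, lt_max_of_lt_right one_pos, fun x => ?_⟩
  by_cases hx : x ∈ Icc (0 : ℝ) 1
  · exact (hK (mem_image_of_mem _ hx)).trans (le_max_left _ _)
  · suffices deriv smoothTransition x = 0 from
      this.le.trans (zero_le_one.trans (le_max_right _ _))
    rcases not_and_or.1 hx with h | h
    · have : smoothTransition =ᶠ[𝓝 x] fun _ => 0 := by
        filter_upwards [Iio_mem_nhds (not_le.1 h)] with y hy
        exact smoothTransition.zero_of_nonpos (le_of_lt hy)
      rw [this.deriv_eq, deriv_const]
    · have : smoothTransition =ᶠ[𝓝 x] fun _ => 1 := by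
        filter_upwards [Ioi_mem_nhds (not_le.1 h)] with y hy
        exact smoothTransition.one_of_one_le (le_of_lt hy)
      rw [this.deriv_eq, deriv_const]

/-- For all `D, E > 0` there is a smooth bump, equal to `1` near some `b < E / 2` and supported in
`[b / 10, E]`, whose derivative at `u > 0` is at least `-D / u`: it decays linearly in `log u`. -/
theorem exists_bump_neg_div_le_deriv {D E : ℝ} (hD : 0 < D) (hE : 0 < E) :
    ∃ b : ℝ, 0 < b ∧ b < E / 2 ∧ ∃ h : ℝ → ℝ, ContDiff ℝ (⊤ : ℕ∞) h ∧
      (∀ u, 0 ≤ h u) ∧ (∀ u, h u ≤ 1) ∧ (∀ u ≤ b / 10, h u = 0) ∧ (∀ u, E ≤ u → h u = 0) ∧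
      (∀ᶠ u in 𝓝 b, h u = 1) ∧ ∀ u, 0 < u → -(D / u) ≤ deriv h u := by
  obtain ⟨K, hK, hKle⟩ := exists_deriv_smoothTransition_le
  set L := K / D with hL
  have hLpos : 0 < L := div_pos hK hD
  set b := E * exp (-L) / 2 with hb
  have hbpos : 0 < b := by positivity
  have hbE : b < E / 2 := by
    have : exp (-L) < 1 := by simpa using hLpos
    rw [hb]
    nlinarith
  set R : ℝ → ℝ := fun u => smoothTransition (10 * u / b - 1)
  set F : ℝ → ℝ := fun u => smoothTransition ((log E - log u) / L)
  have hR0 : ∀ u ≤ b / 10, R u = 0 := fun u hu =>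
    smoothTransition.zero_of_nonpos (by rw [sub_nonpos, div_le_one hbpos]; linarith)
  have hRmono : Monotone R := fun x y hxy => smoothTransition.monotone (by gcongr)
  have hRs : ContDiff ℝ (⊤ : ℕ∞) R := smoothTransition.contDiff.comp (by fun_prop)
  have hFs : ∀ u, 0 < u → ContDiffAt ℝ (⊤ : ℕ∞) F u := fun u hu =>
    smoothTransition.contDiff.contDiffAt.comp u
      ((contDiffAt_const.sub (contDiffAt_log.2 hu.ne')).div_const L)
  refine ⟨b, hbpos, hbE, fun u => R u * F u, ?_, fun u => ?_, fun u => ?_, fun u hu => ?_,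
    fun u hu => ?_, ?_, fun u hu => ?_⟩
  · refine contDiff_iff_contDiffAt.2 fun u => ?_
    rcases lt_or_ge 0 u with hu | hu
    · exact hRs.contDiffAt.mul (hFs u hu)
    · refine (contDiffAt_const (c := (0 : ℝ))).congr_of_eventuallyEq ?_
      filter_upwards [Iio_mem_nhds (show u < b / 10 by linarith)] with y hy
      rw [hR0 y (le_of_lt hy), zero_mul]
  · exact mul_nonneg (smoothTransition.nonneg _) (smoothTransition.nonneg _)
  · exact mul_le_one₀ (smoothTransition.le_one _) (smoothTransition.nonneg _)
      (smoothTransition.le_one _)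
  · simp only [hR0 u hu, zero_mul]
  · have : F u = 0 := smoothTransition.zero_of_nonpos
      (div_nonpos_of_nonpos_of_nonneg (sub_nonpos.2 (log_le_log hE hu)) hLpos.le)
    simp only [this, mul_zero]
  · filter_upwards [Ioo_mem_nhds (show b / 2 < b by linarith) (show b < 2 * b by linarith)]
      with u hu
    have hupos : 0 < u := by linarith [hu.1]
    have h1 : R u = 1 := smoothTransition.one_of_one_le (by
      rw [le_sub_iff_add_le, le_div_iff₀ hbpos]; linarith [hu.1])
    have h2 : F u = 1 := smoothTransition.one_of_one_le (by
      rw [le_div_iff₀ hLpos]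
      have : log u ≤ log (E * exp (-L)) := log_le_log hupos (by linarith [hu.2])
      rw [log_mul hE.ne' (exp_pos _).ne', log_exp] at this
      linarith)
    simp only [h1, h2, mul_one]
  · have hFd : HasDerivAt F
        (deriv smoothTransition ((log E - log u) / L) * (-u⁻¹ / L)) u :=
      HasDerivAt.comp u
        ((smoothTransition.contDiff (n := 1)).differentiable one_ne_zero _).hasDerivAt
        (((Real.hasDerivAt_log hu.ne').const_sub _).div_const L)
    have hRd : HasDerivAt R (deriv R u) u :=
      (hRs.differentiable (by simp) u).hasDerivAt
    have hRF : deriv (fun u => R u * F u) u = _ := (hRd.mul hFd).deriv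
    rw [hRF]
    set T := deriv smoothTransition ((log E - log u) / L)
    have hT : T ≤ K := hKle _
    have hT0 : 0 ≤ T := smoothTransition.monotone.deriv_nonneg
    have h1 : 0 ≤ deriv R u * F u :=
      mul_nonneg hRmono.deriv_nonneg (smoothTransition.nonneg _)
    have h2 : R u * T ≤ K :=
      (mul_le_of_le_one_left hT0 (smoothTransition.le_one _)).trans hT
    have h3 : R u * (T * (-u⁻¹ / L)) = -(R u * T * (D / K / u)) := by
      rw [hL]; field_simp
    have h4 : R u * T * (D / K / u) ≤ K * (D / K / u) := by gcongr
    have h5 : K * (D / K / u) = D / u := by field_simp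
    linarith

/-- A smooth function on `ℝ` has a smooth antiderivative. -/
theorem contDiff_integral_of_contDiff {h : ℝ → ℝ} (hh : ContDiff ℝ (⊤ : ℕ∞) h) (a : ℝ) :
    ContDiff ℝ (⊤ : ℕ∞) (fun u => ∫ x in a..u, h x) := by
  refine contDiff_infty_iff_deriv.2 ⟨fun u =>
    (hh.continuous.integral_hasStrictDerivAt a u).hasDerivAt.differentiableAt, ?_⟩
  rwa [show deriv (fun u => ∫ x in a..u, h x) = h from
    funext fun u => hh.continuous.deriv_integral h a u]


/-- Lemma 5.7: the second family of radial reparametrizations. Given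
`D₁ ∈ (0,1]` and `t** > 0`, there are `b̄ ∈ (0, t**/2)`, a continuous
`ē : [0,1] → (0,∞)` and a continuous isotopy `ψ : [0,1] × ℝ → ℝ` through smooth
non-decreasing surjections of `ℝ` (strictly increasing for `s < 1`) with the listed
properties (i)–(vi), where `ā = b̄/10` and `c̄_s = inf {u : ψ_s(u) = 9t**/10}`. -/
theorem stmt18 (D₁ tss : ℝ) (hD₁ : D₁ ∈ Set.Ioc (0 : ℝ) 1) (htss : 0 < tss) :
    ∃ bbar : ℝ, 0 < bbar ∧ bbar < tss / 2 ∧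
    ∃ ebar : ℝ → ℝ, ContinuousOn ebar (Set.Icc 0 1) ∧
      (∀ s ∈ Set.Icc (0 : ℝ) 1, 0 < ebar s) ∧
    ∃ ψ : ℝ → ℝ → ℝ,
      ContinuousOn (fun p : ℝ × ℝ => ψ p.1 p.2) (Set.Icc 0 1 ×ˢ (Set.univ : Set ℝ)) ∧
      (∀ u : ℝ, ψ 0 u = u) ∧
      (∀ m : ℕ, 1 ≤ m → iteratedDeriv m (ψ 1) bbar = 0) ∧
      ∀ s ∈ Set.Icc (0 : ℝ) 1,
        ContDiff ℝ (⊤ : ℕ∞) (ψ s) ∧ Monotone (ψ s) ∧ Function.Surjective (ψ s) ∧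
        (s < 1 → StrictMono (ψ s)) ∧
        bbar / 10 < bbar ∧
        bbar < sInf {u : ℝ | ψ s u = 9 * tss / 10} ∧
        sInf {u : ℝ | ψ s u = 9 * tss / 10} < ebar s ∧
        ψ s 0 = 0 ∧ ψ s (ebar s) = tss ∧
        (∀ u : ℝ, 0 ≤ deriv (ψ s) u ∧ deriv (ψ s) u ≤ 1) ∧
        (∀ u ≤ bbar / 10, deriv (ψ s) u = 1) ∧
        (∀ u : ℝ, ebar s ≤ u → deriv (ψ s) u = 1) ∧
        (∀ u : ℝ, 0 < u → iteratedDeriv 2 (ψ s) u ≤ D₁ / u) := by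
  obtain ⟨hD, -⟩ := hD₁
  set E := 9 * tss / 10 with hE
  have hEpos : 0 < E := by positivity
  obtain ⟨b, hb, hbE, h, hs, h0, h1, hl, hr, hnear, hd⟩ := exists_bump_neg_div_le_deriv hD hEpos
  set G : ℝ → ℝ := fun u => ∫ x in (0 : ℝ)..u, h x with hG
  have hGs : ContDiff ℝ (⊤ : ℕ∞) G := contDiff_integral_of_contDiff hs 0
  have hGd : ∀ u, HasDerivAt G (h u) u := fun u =>
    (hs.continuous.integral_hasStrictDerivAt 0 u).hasDerivAt
  have hGmono : Monotone G :=
    monotone_of_deriv_nonneg (fun u => (hGd u).differentiableAt) fun u => (hGd u).deriv ▸ h0 u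
  have hG0 : G 0 = 0 := intervalIntegral.integral_same
  have hGneg : ∀ u ≤ 0, G u = 0 := fun u hu => by
    refine (intervalIntegral.integral_congr (g := fun _ => 0) fun x hx => ?_).trans (by simp)
    rw [uIcc_of_ge hu] at hx
    exact hl x (by linarith [hx.2])
  have hGE : ∀ u, E ≤ u → G u = G E := fun u hu => by
    have hi : ∀ p q : ℝ, IntervalIntegrable h MeasureTheory.volume p q :=
      fun p q => hs.continuous.intervalIntegrable p q
    have h2 : ∫ x in E..u, h x = 0 := by
      refine (intervalIntegral.integral_congr (g := fun _ => 0) fun x hx => ?_).trans (by simp)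
      rw [uIcc_of_le hu] at hx
      exact hr x hx.1
    have := intervalIntegral.integral_add_adjacent_intervals (hi 0 E) (hi E u)
    simp only [hG]
    linarith
  have hGnn : ∀ u, 0 ≤ G u := fun u => by
    rcases le_total u 0 with hu | hu
    · exact (hGneg u hu).ge
    · exact hG0 ▸ hGmono hu
  have hψd : ∀ s u, HasDerivAt (fun u => u - s * G u) (1 - s * h u) u := fun s u =>
    (hasDerivAt_id u).sub ((hGd u).const_mul s)
  have hψd' : ∀ s, deriv (fun u => u - s * G u) = fun u => 1 - s * h u := fun s =>
    funext fun u => (hψd s u).deriv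
  refine ⟨b, hb, by linarith, fun s => tss + s * G E, by fun_prop, fun s hs => ?_,
    fun s u => u - s * G u, ?_, fun u => by simp, fun m hm => ?_, fun s hs01 => ?_⟩
  · have := mul_nonneg hs.1 (hGnn E)
    linarith
  · have := hGs.continuous
    fun_prop
  · obtain ⟨k, rfl⟩ : ∃ k, m = k + 1 := ⟨m - 1, by omega⟩
    have : (fun u => 1 - 1 * h u) =ᶠ[𝓝 b] fun _ => 0 := by
      filter_upwards [hnear] with u hu
      rw [hu]; norm_num
    rw [iteratedDeriv_succ', hψd', this.iteratedDeriv_eq]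
    simp
  obtain ⟨hs0, hs1⟩ := hs01
  have hsG : 0 ≤ s * G E := mul_nonneg hs0 (hGnn E)
  have hψs : ContDiff ℝ (⊤ : ℕ∞) (fun u => u - s * G u) := contDiff_id.sub (contDiff_const.mul hGs)
  have hsh : ∀ u, 0 ≤ s * h u ∧ s * h u ≤ s := fun u =>
    ⟨mul_nonneg hs0 (h0 u), mul_le_of_le_one_right hs0 (h1 u)⟩
  have hlow : ∀ u ∈ {u : ℝ | u - s * G u = E}, E ≤ u := fun u hu => by
    have h2 : u - s * G u = E := hu
    linarith [mul_nonneg hs0 (hGnn u)]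
  have hmem : E + s * G E ∈ {u : ℝ | u - s * G u = E} := by
    change E + s * G E - s * G (E + s * G E) = E
    rw [hGE (E + s * G E) (by linarith)]
    ring
  refine ⟨hψs, ?_, ?_, fun hlt => ?_, by linarith, ?_, ?_, ?_, ?_, fun u => ?_, fun u hu => ?_,
    fun u hu => ?_, fun u hu => ?_⟩
  · exact monotone_of_deriv_nonneg (fun u => (hψd s u).differentiableAt) fun u => by
      rw [hψd']; linarith [hsh u]
  · refine hψs.continuous.surjective ?_ ?_
    · refine (tendsto_atTop_add_const_right atTop (-(s * G E)) tendsto_id).congr' ?_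
      filter_upwards [eventually_ge_atTop E] with u hu
      rw [hGE u hu, id, sub_eq_add_neg]
    · refine tendsto_id.congr' ?_
      filter_upwards [eventually_le_atBot 0] with u hu
      rw [hGneg u hu, id, mul_zero, sub_zero]
  · exact strictMono_of_deriv_pos fun u => by
      rw [hψd']; linarith [hsh u]
  · exact lt_of_lt_of_le (by linarith) (le_csInf ⟨_, hmem⟩ hlow)
  · exact (csInf_le ⟨E, hlow⟩ hmem).trans_lt (by linarith)
  · simp [hG0]
  · change tss + s * G E - s * G (tss + s * G E) = tss
    rw [hGE (tss + s * G E) (by linarith)]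
    ring
  · rw [hψd']
    constructor <;> linarith [hsh u]
  · simp [hψd', hl u hu]
  · simp [hψd', hr u (by linarith)]
  · have hh : HasDerivAt (fun u => 1 - s * h u) (-(s * deriv h u)) u :=
      ((hs.differentiable (by simp) u).hasDerivAt.const_mul s).const_sub 1
    rw [iteratedDeriv_succ, iteratedDeriv_one, hψd', hh.deriv]
    have hDu : 0 ≤ D₁ / u := by positivity
    nlinarith [mul_le_mul_of_nonneg_left (hd u hu) hs0, mul_le_of_le_one_left hDu hs1]
end

section
/- Let X be a topological space and A ⊆ X a subspace. Assume that for every compact topological space S and every continuous map g: S → X there exists a continuous map H: S × [0,1] → X such that H(ξ,0) = g(ξ) for all ξ ∈ S, H(ξ,1) ∈ A for all ξ ∈ S, and H(ξ,t) ∈ A for all t ∈ [0,1] whenever g(ξ) ∈ A. Then the inclusion A ↪ X is a weak homotopy equivalence: (a) every point of X is joined by a path in X to a point of A; (b) any two points of A that are joined by a path in X are joined by a path in A; (c) for every a ∈ A and every n ≥ 1 the map π_n(A, a) → π_n(X, a) induced by the inclusion is a bijection. -/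
open unitInterval

/-- The affine dilation of the unit interval by the factor `1 + s` about its midpoint, clamped
to the unit interval. -/
noncomputable def unitInterval.stretch (s t : I) : I :=
  Set.projIcc 0 1 zero_le_one (((t : ℝ) - 1 / 2) * (1 + s) + 1 / 2)

/-- A bump function on the unit interval vanishing at the endpoints and equal to `1` on the
middle half. -/
noncomputable def unitInterval.bump (t : I) : I :=
  Set.projIcc 0 1 zero_le_one (4 * (t : ℝ)) * Set.projIcc 0 1 zero_le_one (4 * (1 - (t : ℝ)))

namespace unitInterval

@[fun_prop]
theorem continuous_stretch : Continuous fun p : I × I => stretch p.1 p.2 :=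
  continuous_projIcc.comp (by fun_prop)

@[fun_prop]
theorem continuous_stretch_right (s : I) : Continuous (stretch s) :=
  continuous_stretch.comp (Continuous.prodMk_right s)

@[fun_prop]
theorem continuous_bump : Continuous bump :=
  (continuous_projIcc.comp (by fun_prop)).mul (continuous_projIcc.comp (by fun_prop))

@[simp]
theorem stretch_zero_left (t : I) : stretch 0 t = t := by
  simp [stretch]

@[simp]
theorem stretch_zero_right (s : I) : stretch s 0 = 0 :=
  Set.projIcc_of_le_left _ (by have := s.2.1; simp only [Set.Icc.coe_zero]; linarith)

@[simp]
theorem stretch_one_right (s : I) : stretch s 1 = 1 :=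
  Set.projIcc_of_right_le _ (by have := s.2.1; simp only [Set.Icc.coe_one]; linarith)

@[simp]
theorem bump_zero : bump 0 = 0 := by
  simp [bump]

@[simp]
theorem bump_one : bump 1 = 0 := by
  simp [bump]

theorem bump_eq_one_or_stretch (t : I) : bump t = 1 ∨ stretch 1 t = 0 ∨ stretch 1 t = 1 := by
  rcases le_or_gt (t : ℝ) (1 / 4) with h₀ | h₀
  · exact .inr <| .inl <| Set.projIcc_of_le_left _ (by simp only [Set.Icc.coe_one]; linarith)
  rcases le_or_gt (3 / 4) (t : ℝ) with h₁ | h₁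
  · exact .inr <| .inr <| Set.projIcc_of_right_le _ (by simp only [Set.Icc.coe_one]; linarith)
  · left
    rw [bump, Set.projIcc_of_right_le _ (by linarith), Set.projIcc_of_right_le _ (by linarith)]
    exact mul_one (1 : I)

end unitInterval

namespace Cube

variable {N : Type*}

theorem stretch_mem_boundary (s : I) {y : N → I} (hy : y ∈ boundary N) :
    (fun i => stretch s (y i)) ∈ boundary N := by
  obtain ⟨i, h | h⟩ := hy
  · exact ⟨i, .inl (by simp [h])⟩
  · exact ⟨i, .inr (by simp [h])⟩

theorem prod_bump_eq_zero [Fintype N] {y : N → I} (hy : y ∈ boundary N) :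
    ∏ i, bump (y i) = 0 := by
  obtain ⟨i, h | h⟩ := hy <;> exact Finset.prod_eq_zero (Finset.mem_univ i) (by simp [h])

theorem prod_bump_eq_one_or_stretch_mem_boundary [Fintype N] (y : N → I) :
    ∏ i, bump (y i) = 1 ∨ (fun i => stretch 1 (y i)) ∈ boundary N := by
  by_cases h : ∀ i, bump (y i) = 1
  · exact .inl (Finset.prod_eq_one fun i _ => h i)
  · push Not at h
    obtain ⟨i, hi⟩ := h
    exact .inr ⟨i, (bump_eq_one_or_stretch (y i)).resolve_left hi⟩

/-- A map on a cube that is constant on the boundary is homotopic, relative to the boundary, to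
its composition with the clamped dilation by the factor `2`. -/
theorem homotopicRel_comp_stretch {Y : Type*} [TopologicalSpace Y] {b : Y} (f : C(N → I, Y))
    (hf : ∀ y ∈ boundary N, f y = b) :
    f.HomotopicRel (f.comp ⟨fun y i => stretch 1 (y i), by fun_prop⟩) (boundary N) :=
  ⟨{ toFun := fun p => f fun i => stretch p.1 (p.2 i)
     continuous_toFun := by fun_prop
     map_zero_left := fun y => by simp
     map_one_left := fun y => rfl
     prop' := fun s y hy => (hf _ (stretch_mem_boundary s hy)).trans (hf y hy).symm }⟩

end Cube

/-- abstract deformation principle behind Theorem 3.5: if every compact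
family in `X` can be continuously deformed into the subspace `A`, keeping families that
start in `A` inside `A`, then the inclusion `A ↪ X` is a weak homotopy equivalence:
(a) every point of `X` is joined by a path to a point of `A`; (b) two points of `A`
joined by a path in `X` are joined by a path in `A`; (c) for every basepoint `a ∈ A` and
`n ≥ 1` the induced map `π_n(A, a) → π_n(X, a)` is bijective (surjectivity and
injectivity being expressed via cubes rel boundary). -/
theorem stmt19 (X : Type) [TopologicalSpace X] (A : Set X)
    (hdef : ∀ (S : Type) [TopologicalSpace S] [CompactSpace S] (g : S → X), Continuous g →
      ∃ H : S × I → X, Continuous H ∧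
        (∀ ξ : S, H (ξ, 0) = g ξ) ∧
        (∀ ξ : S, H (ξ, 1) ∈ A) ∧
        (∀ ξ : S, g ξ ∈ A → ∀ t : I, H (ξ, t) ∈ A)) :
    (∀ x : X, ∃ a ∈ A, Joined x a) ∧
    (∀ a₁ ∈ A, ∀ a₂ ∈ A, Joined a₁ a₂ → JoinedIn A a₁ a₂) ∧
    (∀ (a : X) (ha : a ∈ A), ∀ n : ℕ, 1 ≤ n →
      (∀ f : C(Fin n → I, X), (∀ y ∈ Cube.boundary (Fin n), f y = a) →
        ∃ g : C(Fin n → I, ↥A), (∀ y ∈ Cube.boundary (Fin n), g y = ⟨a, ha⟩) ∧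
          ContinuousMap.HomotopicRel
            ((⟨Subtype.val, continuous_subtype_val⟩ : C(↥A, X)).comp g) f
            (Cube.boundary (Fin n))) ∧
      (∀ g₁ g₂ : C(Fin n → I, ↥A),
        (∀ y ∈ Cube.boundary (Fin n), g₁ y = ⟨a, ha⟩) →
        (∀ y ∈ Cube.boundary (Fin n), g₂ y = ⟨a, ha⟩) →
        ContinuousMap.HomotopicRel
          ((⟨Subtype.val, continuous_subtype_val⟩ : C(↥A, X)).comp g₁)
          ((⟨Subtype.val, continuous_subtype_val⟩ : C(↥A, X)).comp g₂)
          (Cube.boundary (Fin n)) →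
        ContinuousMap.HomotopicRel g₁ g₂ (Cube.boundary (Fin n)))) := by
  refine ⟨fun x => ?_, fun a₁ h₁ a₂ h₂ ⟨p⟩ => ?_, fun a ha n _ => ⟨fun f hf => ?_, ?_⟩⟩
  · obtain ⟨H, hH, H0, H1, -⟩ := hdef Unit (fun _ => x) continuous_const
    exact ⟨H ((), 1), H1 _, ⟨⟨⟨fun t => H ((), t), by fun_prop⟩, H0 _, rfl⟩⟩⟩
  · obtain ⟨H, hH, H0, H1, HA⟩ := hdef I p p.continuous
    refine ⟨⟨⟨fun t => H (stretch 1 t, bump t), by fun_prop⟩, by simp [H0], by simp [H0]⟩,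
      fun t => ?_⟩
    change H (stretch 1 t, bump t) ∈ A
    rcases bump_eq_one_or_stretch t with h | h | h
    · rw [h]; exact H1 _
    · exact HA _ (by simpa [h] using h₁) _
    · exact HA _ (by simpa [h] using h₂) _
  · obtain ⟨H, hH, H0, H1, HA⟩ := hdef (Fin n → I) f f.continuous
    have hmem (y : Fin n → I) : H (fun i => stretch 1 (y i), ∏ i, bump (y i)) ∈ A := by
      rcases Cube.prod_bump_eq_one_or_stretch_mem_boundary y with h | h
      · rw [h]; exact H1 _
      · exact HA _ (by rwa [hf _ h]) _
    have hbd (y : Fin n → I) (hy : y ∈ Cube.boundary (Fin n)) (s : I) :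
        H (fun i => stretch 1 (y i), s * ∏ i, bump (y i)) = a := by
      rw [Cube.prod_bump_eq_zero hy, mul_zero, H0, hf _ (Cube.stretch_mem_boundary 1 hy)]
    refine ⟨⟨fun y => ⟨_, hmem y⟩, by fun_prop⟩, fun y hy => Subtype.ext ?_, ?_⟩
    · simpa using hbd y hy 1
    · refine ((Cube.homotopicRel_comp_stretch f hf).trans ⟨
        { toFun := fun p => H (fun i => stretch 1 (p.2 i), p.1 * ∏ i, bump (p.2 i))
          continuous_toFun := by fun_prop
          map_zero_left := fun y => by simp [H0]
          map_one_left := fun y => by simp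
          prop' := fun s y hy => ?_ }⟩).symm
      exact (hbd y hy s).trans (hf _ (Cube.stretch_mem_boundary 1 hy)).symm
  · rintro g₁ g₂ hg₁ hg₂ ⟨F⟩
    have hF (s : I) (y : Fin n → I) (hy : y ∈ Cube.boundary (Fin n)) : F (s, y) = a := by
      rw [F.eq_fst s hy]
      exact congrArg Subtype.val (hg₁ y hy)
    have hF0 (y : Fin n → I) : F (0, y) = g₁ y := F.apply_zero y
    have hF1 (y : Fin n → I) : F (1, y) = g₂ y := F.apply_one y
    obtain ⟨H, hH, H0, H1, HA⟩ := hdef (I × (Fin n → I)) F F.continuous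
    have hmem (p : I × (Fin n → I)) :
        H ((stretch 1 p.1, fun i => stretch 1 (p.2 i)), bump p.1 * ∏ i, bump (p.2 i)) ∈ A := by
      rcases Cube.prod_bump_eq_one_or_stretch_mem_boundary p.2 with h | h
      · rcases bump_eq_one_or_stretch p.1 with h' | h' | h'
        · rw [h, h', mul_one]
          exact H1 _
        · exact HA _ (by rw [h', hF0]; exact Subtype.coe_prop _) _
        · exact HA _ (by rw [h', hF1]; exact Subtype.coe_prop _) _
      · exact HA _ (by rwa [hF _ _ h]) _
    refine (Cube.homotopicRel_comp_stretch g₁ hg₁).trans (.trans ⟨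
      { toFun := fun p => ⟨_, hmem p⟩
        continuous_toFun := by fun_prop
        map_zero_left := fun y => Subtype.ext (by simp [H0, hF0])
        map_one_left := fun y => Subtype.ext (by simp [H0, hF1])
        prop' := fun s y hy => Subtype.ext ?_ }⟩
      (Cube.homotopicRel_comp_stretch g₂ hg₂).symm)
    have hy' := Cube.stretch_mem_boundary 1 hy
    simp [Cube.prod_bump_eq_zero hy, H0, hF _ _ hy', hg₁ _ hy']
end
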